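/- arXiv:2511.15395 — 10 statements merged into one kernel-verified Lean document; each statement's English description precedes it below -/
import Mathlib

section
/- Let d ≥ 1 and let V be the d×d real matrix with entries V_{i,j} = i^j / j for i,j = 1,…,d (the histopolation Vandermonde matrix, in the monomial basis, of the segments s_i = [0,i]). Then V is invertible and its spectral condition number satisfies ‖V‖₂ · ‖V⁻¹‖₂ ≥ d^{d−1} · √(6 / (d(d+1)(2d+1))). -/
open Real Matrix

/-- The spectral (operator) norm of a real `d × d` matrix, acting on `ℝ^d`
with the Euclidean norm. -/
noncomputable def specNorm {d : ℕ} (A : Matrix (Fin d) (Fin d) ℝ) : ℝ :=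
  ‖Matrix.toEuclideanCLM (𝕜 := ℝ) A‖

theorem aux_sum (d : ℕ) : ∑ i : Fin d, ((i.1 : ℝ) + 1) ^ 2 =
    (d : ℝ) * ((d : ℝ) + 1) * (2 * (d : ℝ) + 1) / 6 := by
  rw [Fin.sum_univ_eq_sum_range (fun i => ((i : ℝ) + 1) ^ 2)]
  induction d with
  | zero => simp
  | succ n ih => rw [Finset.sum_range_succ, ih]; push_cast; ring

theorem aux_det (d : ℕ) (V : Matrix (Fin d) (Fin d) ℝ)
    (hV : ∀ i j : Fin d,
      V i j = ((i.1 + 1 : ℝ) ^ (j.1 + 1)) / (j.1 + 1)) : IsUnit V.det := by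
  have h : V = Matrix.of fun i j : Fin d => ((i.1 : ℝ) + 1) *
      (Matrix.of fun i j : Fin d => (1 / ((j.1 : ℝ) + 1)) *
        Matrix.vandermonde (fun i : Fin d => (i.1 : ℝ) + 1) i j) i j := by
    ext i j
    simp only [hV, Matrix.of_apply, Matrix.vandermonde_apply]
    ring
  rw [h, Matrix.det_mul_column, Matrix.det_mul_row, isUnit_iff_ne_zero]
  refine mul_ne_zero (Finset.prod_ne_zero_iff.2 fun i _ => by positivity)
    (mul_ne_zero (Finset.prod_ne_zero_iff.2 fun i _ => by positivity) ?_)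
  rw [Matrix.det_vandermonde_ne_zero_iff]
  intro a b hab
  ext
  simpa using hab

/-- for `V i j = i^j / j` (1-indexed), `V` is invertible and
`‖V‖₂ ‖V⁻¹‖₂ ≥ d^(d-1) √(6/(d(d+1)(2d+1)))`. -/
theorem stmt_0 (d : ℕ) (hd : 1 ≤ d) (V : Matrix (Fin d) (Fin d) ℝ)
    (hV : ∀ i j : Fin d,
      V i j = ((i.1 + 1 : ℝ) ^ (j.1 + 1)) / (j.1 + 1)) :
    IsUnit V.det ∧
      (d : ℝ) ^ (d - 1) * Real.sqrt (6 / (d * (d + 1) * (2 * d + 1)))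
        ≤ specNorm V * specNorm V⁻¹ := by
  have hu := aux_det d V hV
  refine ⟨hu, ?_⟩
  obtain ⟨n, rfl⟩ : ∃ n, d = n + 1 := ⟨d - 1, by omega⟩
  have h1 : ((n + 1 : ℕ) : ℝ) ^ (n + 1 - 1) ≤ specNorm V := by
    have a := (Matrix.toEuclideanCLM (𝕜 := ℝ) V).le_opNorm
      (EuclideanSpace.single (Fin.last n) (1 : ℝ))
    rw [EuclideanSpace.norm_single, norm_one, mul_one] at a
    have b := PiLp.norm_apply_le (Matrix.toEuclideanCLM (𝕜 := ℝ) V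
      (EuclideanSpace.single (Fin.last n) (1 : ℝ))) (Fin.last n)
    refine le_trans (le_of_eq ?_) (b.trans a)
    have hp : (n : ℝ) + 1 ≠ 0 := by positivity
    have : (Matrix.toEuclideanCLM (𝕜 := ℝ) V
      (EuclideanSpace.single (Fin.last n) (1 : ℝ))) (Fin.last n) = ((n : ℝ) + 1) ^ n := by
      have : (Matrix.toEuclideanCLM (𝕜 := ℝ) V
        (EuclideanSpace.single (Fin.last n) (1 : ℝ))) (Fin.last n) = V (Fin.last n) (Fin.last n) := by
        simp [Matrix.ofLp_toEuclideanCLM]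
      rw [this, hV]
      simp only [Fin.val_last]
      rw [pow_succ]
      field_simp
    rw [this, Real.norm_of_nonneg (by positivity)]
    push_cast
    simp
  have h2 : Real.sqrt (6 / ((n + 1 : ℕ) * ((n + 1 : ℕ) + 1) * (2 * (n + 1 : ℕ) + 1)))
      ≤ specNorm V⁻¹ := by
    set x := Matrix.toEuclideanCLM (𝕜 := ℝ) V (EuclideanSpace.single (0 : Fin (n+1)) (1 : ℝ)) with hx
    have hxn : ‖x‖ = Real.sqrt ((n + 1 : ℕ) * ((n + 1 : ℕ) + 1) * (2 * (n + 1 : ℕ) + 1) / 6) := by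
      rw [EuclideanSpace.norm_eq, ← aux_sum]
      congr 1
      refine Finset.sum_congr rfl fun i _ => ?_
      have : x i = V i 0 := by simp [hx, Matrix.ofLp_toEuclideanCLM]
      rw [this, hV]
      simp
    have a := (Matrix.toEuclideanCLM (𝕜 := ℝ) V⁻¹).le_opNorm x
    have e : Matrix.toEuclideanCLM (𝕜 := ℝ) V⁻¹ x = EuclideanSpace.single (0 : Fin (n+1)) (1 : ℝ) := by
      rw [hx, ← ContinuousLinearMap.mul_apply, ← map_mul, Matrix.nonsing_inv_mul _ hu, map_one]
      rfl
    rw [e, EuclideanSpace.norm_single, norm_one] at a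
    have hpos : 0 < ‖x‖ := by rw [hxn]; positivity
    rw [← inv_div, Real.sqrt_inv, ← hxn, inv_le_iff_one_le_mul₀ hpos]
    exact a
  exact mul_le_mul h1 h2 (Real.sqrt_nonneg _) (norm_nonneg _)
end

section
/- Let d ≥ 1, let α ∈ ℝ and let β_1, …, β_d ∈ ℝ. The d×d real matrix V with entries V_{i,j} = (β_i^j − α^j)/j (the histopolation Vandermonde matrix, in the monomial basis, of the class-(C3) segments s_i = [α, β_i]) satisfies det V = (1/d!) · (∏_{i=1}^d (β_i − α)) · (∏_{1 ≤ j < k ≤ d} (β_k − β_j)). In particular, if α < β_1 < β_2 < ⋯ < β_d, then det V > 0. -/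
open Real Matrix Finset

theorem aux_det_s2 (d : ℕ) (α : ℝ) (β : Fin d → ℝ) :
    (Matrix.of fun i j : Fin d => (β i) ^ (j.1 + 1) - α ^ (j.1 + 1)).det =
      (∏ i, (β i - α)) * (∏ j : Fin d, ∏ k ∈ Finset.Ioi j, (β k - β j)) := by
  have h1 : (vandermonde (Fin.cons α β : Fin (d+1) → ℝ)).det =
      (∏ i, (β i - α)) * (∏ j : Fin d, ∏ k ∈ Finset.Ioi j, (β k - β j)) := by
    rw [det_vandermonde, Fin.prod_univ_succ]
    simp [Fin.prod_Ioi_zero, Fin.prod_Ioi_succ]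
  rw [← h1]
  let M : Matrix (Fin (d+1)) (Fin (d+1)) ℝ := Matrix.of
    (Fin.cons (fun j => α ^ j.1) (fun i j => β i ^ j.1 - α ^ j.1))
  have h2 : (vandermonde (Fin.cons α β : Fin (d+1) → ℝ)).det = M.det := by
    refine det_eq_of_forall_row_eq_smul_add_const (fun i => if i = 0 then 0 else 1) 0 (by simp) ?_
    intro i j
    refine Fin.cases ?_ (fun i => ?_) i <;> simp [M, vandermonde_apply]
  rw [h2, det_succ_column_zero, Fin.sum_univ_succ]
  simp [M]
  congr 1

/-- determinant of the class-(C3) histopolation Vandermonde matrix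
`V i j = (β_i^j − α^j)/j` (1-indexed), and its positivity when
`α < β_1 < β_2 < ⋯ < β_d`. -/
theorem stmt_2 (d : ℕ) (hd : 1 ≤ d) (α : ℝ) (β : Fin d → ℝ)
    (V : Matrix (Fin d) (Fin d) ℝ)
    (hV : ∀ i j : Fin d,
      V i j = ((β i) ^ (j.1 + 1) - α ^ (j.1 + 1)) / (j.1 + 1)) :
    V.det = (1 / (Nat.factorial d : ℝ)) * (∏ i, (β i - α)) *
        (∏ j : Fin d, ∏ k ∈ Finset.Ioi j, (β k - β j)) ∧
      ((∀ i, α < β i) → StrictMono β → 0 < V.det) := by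
  have hV' : V = Matrix.of fun i j : Fin d => (((j.1 : ℝ) + 1)⁻¹) *
      (Matrix.of fun i j : Fin d => (β i) ^ (j.1 + 1) - α ^ (j.1 + 1)) i j := by
    ext i j
    rw [hV]
    simp [div_eq_inv_mul]
  have hf : ∏ j : Fin d, ((j.1 : ℝ) + 1)⁻¹ = 1 / (Nat.factorial d : ℝ) := by
    rw [Finset.prod_inv_distrib, one_div, Fin.prod_univ_eq_prod_range (fun j => (j : ℝ) + 1) d,
      ← Finset.prod_range_add_one_eq_factorial]
    push_cast
    rfl
  have h : V.det = (1 / (Nat.factorial d : ℝ)) * (∏ i, (β i - α)) *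
        (∏ j : Fin d, ∏ k ∈ Finset.Ioi j, (β k - β j)) := by
    rw [hV', det_mul_row, aux_det_s2, hf, mul_assoc]
  refine ⟨h, fun h1 h2 => ?_⟩
  rw [h]
  refine mul_pos (mul_pos (by positivity) (Finset.prod_pos fun i _ => sub_pos.2 (h1 i))) ?_
  exact Finset.prod_pos fun j _ => Finset.prod_pos fun k hk =>
    sub_pos.2 (h2 (Finset.mem_Ioi.1 hk))
end

section
/- Let d ≥ 1, let α ∈ ℝ and let β_1, …, β_d ∈ ℝ with β_i ≠ α for every i. The normalized histopolation Vandermonde matrix Ṽ with entries Ṽ_{i,j} = (β_i^j − α^j) / (j·(β_i − α)) (i.e. Ṽ_{i,j} = (1/|s_i|)∫_{s_i} x^{j−1} dx for the class-(C3) segments s_i = [α, β_i]) satisfies det Ṽ = (1/d!) · ∏_{1 ≤ j < k ≤ d} (β_k − β_j). Consequently |det Ṽ| is maximized over choices of β_1,…,β_d in a compact interval exactly when the nodes β_1,…,β_d maximize ∏_{1 ≤ j < k ≤ d} |β_k − β_j| (i.e. when they are Fekete nodes). -/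
open Real Matrix Finset

theorem det_aux (d : ℕ) (α : ℝ) (M : Matrix (Fin d) (Fin d) ℝ) (γ : Fin d → ℝ)
    (hM : ∀ i j : Fin d,
      M i j = ((γ i) ^ (j.1 + 1) - α ^ (j.1 + 1)) / ((j.1 + 1) * (γ i - α)))
    (hγ : ∀ i, γ i ≠ α) :
    M.det = (1 / (Nat.factorial d : ℝ)) *
        (∏ j : Fin d, ∏ k ∈ Finset.Ioi j, (γ k - γ j)) := by
  let U : Matrix (Fin d) (Fin d) ℝ := Matrix.of fun k j =>
    if k.1 < j.1 + 1 then α ^ (j.1 - k.1) / (j.1 + 1) else 0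
  have hMU : M = Matrix.vandermonde γ * U := by
    ext i j
    rw [hM, Matrix.mul_apply]
    have h1 : γ i - α ≠ 0 := sub_ne_zero.mpr (hγ i)
    have h2 : ((j.1 : ℝ) + 1) ≠ 0 := by positivity
    have h3 : (∑ k : Fin d, Matrix.vandermonde γ i k * U k j)
        = ∑ k ∈ Finset.range d,
          if k < j.1 + 1 then γ i ^ k * (α ^ (j.1 - k) / (j.1 + 1)) else 0 := by
      rw [Finset.sum_range]
      refine Finset.sum_congr rfl fun k _ => ?_
      simp [U, Matrix.vandermonde_apply]
    rw [h3, ← Finset.sum_filter]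
    have h4 : (Finset.range d).filter (fun k => k < j.1 + 1) = Finset.range (j.1 + 1) := by
      ext k
      simp only [Finset.mem_filter, Finset.mem_range]
      have := j.2
      omega
    rw [h4, ← geom_sum₂_mul (γ i) α (j.1 + 1), mul_div_mul_right _ _ h1, Finset.sum_div]
    refine Finset.sum_congr rfl fun k _ => ?_
    rw [Nat.add_sub_cancel, mul_div_assoc]
  have hU : U.det = 1 / (Nat.factorial d : ℝ) := by
    rw [Matrix.det_of_upperTriangular]
    · have : ∀ i : Fin d, U i i = ((i.1 + 1 : ℕ) : ℝ)⁻¹ := by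
        intro i
        simp [U]
      simp only [this]
      rw [Finset.prod_inv_distrib, ← Finset.prod_range (fun i => ((i + 1 : ℕ) : ℝ)),
        ← Nat.cast_prod, Finset.prod_range_add_one_eq_factorial, one_div]
    · intro k j hkj
      have : j.1 < k.1 := hkj
      simp only [U, Matrix.of_apply]
      rw [if_neg (by omega)]
  rw [hMU, Matrix.det_mul, hU, Matrix.det_vandermonde, mul_comm]

/-- the normalized class-(C3) histopolation Vandermonde matrix
`Ṽ i j = (β_i^j − α^j)/(j (β_i − α))` has `det Ṽ = (1/d!) ∏_{j<k} (β_k − β_j)`;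
consequently `|det Ṽ|` is maximized over nodes in a compact interval exactly when
the nodes maximize the Fekete product `∏_{j<k} |β_k − β_j|`. -/
theorem stmt_3 (d : ℕ) (hd : 1 ≤ d) (α : ℝ)
    (Vt : (Fin d → ℝ) → Matrix (Fin d) (Fin d) ℝ)
    (hVt : ∀ γ : Fin d → ℝ, ∀ i j : Fin d,
      Vt γ i j = ((γ i) ^ (j.1 + 1) - α ^ (j.1 + 1)) / ((j.1 + 1) * (γ i - α)))
    (β : Fin d → ℝ) (hβ : ∀ i, β i ≠ α) :
    (Vt β).det = (1 / (Nat.factorial d : ℝ)) *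
        (∏ j : Fin d, ∏ k ∈ Finset.Ioi j, (β k - β j)) ∧
      (∀ a b : ℝ, (∀ i, β i ∈ Set.Icc a b) →
        ((∀ γ : Fin d → ℝ, (∀ i, γ i ∈ Set.Icc a b) → (∀ i, γ i ≠ α) →
            |(Vt γ).det| ≤ |(Vt β).det|) ↔
          (∀ γ : Fin d → ℝ, (∀ i, γ i ∈ Set.Icc a b) → (∀ i, γ i ≠ α) →
            (∏ j : Fin d, ∏ k ∈ Finset.Ioi j, |γ k - γ j|) ≤
              (∏ j : Fin d, ∏ k ∈ Finset.Ioi j, |β k - β j|)))) := by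
  refine ⟨det_aux d α _ β (hVt β) hβ, fun a b _ => ?_⟩
  have key : ∀ γ : Fin d → ℝ, (∀ i, γ i ≠ α) → |(Vt γ).det| = (1 / (Nat.factorial d : ℝ)) *
      (∏ j : Fin d, ∏ k ∈ Finset.Ioi j, |γ k - γ j|) := by
    intro γ hγ
    rw [det_aux d α _ γ (hVt γ) hγ, abs_mul, abs_of_nonneg (by positivity)]
    simp only [Finset.abs_prod]
  have hpos : (0 : ℝ) < 1 / (Nat.factorial d : ℝ) := by positivity
  refine forall_congr' fun γ => forall_congr' fun _ => forall_congr' fun hγ => ?_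
  rw [key γ hγ, key β hβ]
  exact mul_le_mul_iff_right₀ hpos
end

section
/- Let d ≥ 1 and let −1 ≤ α_i < β_i ≤ 1 for i = 1,…,d. Let V be the d×d real matrix with entries V_{i,j} = (β_i^j − α_i^j)/j, and assume V is invertible. Suppose c > 0 satisfies max_{1≤i≤d} (β_i − α_i) ≥ c. Then the spectral condition number satisfies ‖V‖₂ · ‖V⁻¹‖₂ ≥ (c/√d) · 2^{d−2}. -/
open Real Matrix

/-- for segments `[α_i, β_i] ⊆ [-1,1]` whose histopolation Vandermonde
matrix in the monomial basis is invertible, if `max_i (β_i − α_i) ≥ c > 0` then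
`‖V‖₂ ‖V⁻¹‖₂ ≥ (c/√d) 2^(d−2)`. -/
theorem stmt_4 (d : ℕ) (hd : 1 ≤ d) (α β : Fin d → ℝ)
    (hab : ∀ i, α i < β i) (hα : ∀ i, -1 ≤ α i) (hβ : ∀ i, β i ≤ 1)
    (V : Matrix (Fin d) (Fin d) ℝ)
    (hV : ∀ i j : Fin d,
      V i j = ((β i) ^ (j.1 + 1) - (α i) ^ (j.1 + 1)) / (j.1 + 1))
    (hinv : IsUnit V.det)
    (c : ℝ) (hc : 0 < c) (hmax : ∃ i, c ≤ β i - α i) :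
    c / Real.sqrt d * 2 ^ ((d : ℤ) - 2) ≤ specNorm V * specNorm V⁻¹ := by
  obtain ⟨i₀, hi₀⟩ := hmax
  have hdpos : (0:ℝ) < d := by exact_mod_cast hd
  have hd1 : (1:ℝ) ≤ d := by exact_mod_cast hd
  -- coordinates bounded by the norm
  have coord : ∀ (x : EuclideanSpace ℝ (Fin d)) (i : Fin d), |x i| ≤ ‖x‖ := by
    intro x i
    exact PiLp.norm_apply_le x i
  -- lower bound on the norm of V
  have h1 : c ≤ specNorm V := by
    let j0 : Fin d := ⟨0, hd⟩
    let e : EuclideanSpace ℝ (Fin d) := EuclideanSpace.single j0 1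
    have he : ‖e‖ = 1 := by simp [e]
    have h := (Matrix.toEuclideanCLM (𝕜 := ℝ) V).le_opNorm e
    rw [he, mul_one] at h
    have h2 := coord (Matrix.toEuclideanCLM (𝕜 := ℝ) V e) i₀
    have h3 : (Matrix.toEuclideanCLM (𝕜 := ℝ) V e) i₀ = β i₀ - α i₀ := by
      simp [e, Matrix.ofLp_toEuclideanCLM, hV, j0]
    rw [h3] at h2
    unfold specNorm
    linarith [le_abs_self (β i₀ - α i₀)]
  -- the Chebyshev vector
  let T : Polynomial ℝ := Polynomial.Chebyshev.T ℝ d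
  have hTdeg : T.natDegree = d := by simp [T]
  have hTlead : T.coeff d = 2 ^ (d - 1) := by
    have : T.leadingCoeff = 2 ^ (d - 1) := by simp [T]
    rwa [Polynomial.leadingCoeff, hTdeg] at this
  have hTb : ∀ x : ℝ, -1 ≤ x → x ≤ 1 → |T.eval x| ≤ 1 := by
    intro x hx hx'
    exact Polynomial.Chebyshev.abs_eval_T_real_le_one d (abs_le.2 ⟨hx, hx'⟩)
  let a : EuclideanSpace ℝ (Fin d) := WithLp.toLp 2 (fun j => ((j.1:ℝ) + 1) * T.coeff (j.1 + 1))
  have hVa : ∀ i, (Matrix.toEuclideanCLM (𝕜 := ℝ) V a) i = T.eval (β i) - T.eval (α i) := by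
    intro i
    rw [Matrix.ofLp_toEuclideanCLM]
    simp only [a, Matrix.mulVec, dotProduct, hV]
    rw [Polynomial.eval_eq_sum_range, Polynomial.eval_eq_sum_range, hTdeg,
      ← Finset.sum_sub_distrib, Finset.sum_range_succ', Finset.sum_range]
    simp only [pow_zero, sub_self, add_zero]
    apply Finset.sum_congr rfl
    intro j _
    have : ((j.1:ℝ) + 1) ≠ 0 := by positivity
    field_simp
  have hVan : ‖Matrix.toEuclideanCLM (𝕜 := ℝ) V a‖ ≤ 2 * Real.sqrt d := by
    rw [EuclideanSpace.norm_eq]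
    apply Real.sqrt_le_iff.2
    refine ⟨by positivity, ?_⟩
    rw [mul_pow, Real.sq_sqrt hdpos.le]
    calc _ ≤ ∑ i : Fin d, (4:ℝ) := by
          apply Finset.sum_le_sum
          intro i _
          rw [hVa, Real.norm_eq_abs, sq_abs]
          have hb := abs_le.1 (hTb (β i) (by linarith [hα i, hab i]) (hβ i))
          have ha := abs_le.1 (hTb (α i) (hα i) (by linarith [hβ i, hab i]))
          nlinarith
      _ = 2 ^ 2 * (d:ℝ) := by simp; ring
  have hinva : Matrix.toEuclideanCLM (𝕜 := ℝ) V⁻¹ (Matrix.toEuclideanCLM (𝕜 := ℝ) V a) = a := by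
    rw [← ContinuousLinearMap.mul_apply, ← map_mul, Matrix.nonsing_inv_mul _ hinv, map_one]
    rfl
  have hal : (d:ℝ) * 2 ^ (d - 1) ≤ ‖a‖ := by
    have h := coord a ⟨d - 1, by omega⟩
    have h2 : a ⟨d - 1, by omega⟩ = (d:ℝ) * 2 ^ (d - 1) := by
      simp only [a]
      rw [Nat.sub_add_cancel hd, hTlead, Nat.cast_sub hd]
      simp
    rw [h2] at h
    exact (le_abs_self _).trans h
  have h2 := (Matrix.toEuclideanCLM (𝕜 := ℝ) V⁻¹).le_opNorm (Matrix.toEuclideanCLM (𝕜 := ℝ) V a)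
  rw [hinva] at h2
  change _ ≤ specNorm V⁻¹ * _ at h2
  have hn : 0 ≤ specNorm V⁻¹ := norm_nonneg _
  have h3 : (d:ℝ) * 2 ^ (d - 1) ≤ specNorm V⁻¹ * (2 * Real.sqrt d) :=
    hal.trans (h2.trans (mul_le_mul_of_nonneg_left hVan hn))
  have hs : 0 < Real.sqrt d := Real.sqrt_pos.2 hdpos
  have hp : (2:ℝ) ^ ((d:ℤ) - 2) = 2 ^ (d - 1) / 2 := by
    obtain ⟨k, rfl⟩ : ∃ k, d = k + 1 := ⟨d - 1, by omega⟩
    have : ((k + 1 : ℕ) : ℤ) - 2 = (k:ℤ) - 1 := by push_cast; ring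
    rw [this, zpow_sub₀ (by norm_num)]
    simp
  have h4 : (2:ℝ) ^ ((d:ℤ) - 2) / Real.sqrt d ≤ specNorm V⁻¹ := by
    rw [hp, div_le_iff₀ hs]
    have : (2:ℝ) ^ (d - 1) ≤ d * 2 ^ (d - 1) := le_mul_of_one_le_left (by positivity) hd1
    linarith
  calc c / Real.sqrt d * 2 ^ ((d : ℤ) - 2) = c * (2 ^ ((d : ℤ) - 2) / Real.sqrt d) := by ring
    _ ≤ _ := mul_le_mul h1 h4 (by positivity) (hc.le.trans h1)
end

section
/- Let d ≥ 1, let α < β be reals, let ξ_1, …, ξ_d be pairwise distinct reals, and let p be a real polynomial of degree at most d − 1. If ∫_{α+ξ_i}^{β+ξ_i} p(x) dx = 0 for every i = 1,…,d, then p is the zero polynomial (equivalently, p(x) = 0 for every x ∈ ℝ). -/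
open Real MeasureTheory intervalIntegral

lemma exists_antideriv (d : ℕ) (p : Polynomial ℝ) (hp : p.natDegree < d) :
    ∃ P : Polynomial ℝ, P.natDegree ≤ d ∧ Polynomial.derivative P = p := by
  refine ⟨∑ i ∈ Finset.range d, Polynomial.monomial (i+1) (p.coeff i / (i+1)), ?_, ?_⟩
  · apply Polynomial.natDegree_sum_le_of_forall_le
    intro i hi
    have := Finset.mem_range.1 hi
    exact (Polynomial.natDegree_monomial_le _).trans this
  · conv_rhs => rw [p.as_sum_range' d hp]
    rw [Polynomial.derivative_sum]
    refine Finset.sum_congr rfl fun i _ => ?_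
    rw [Polynomial.derivative_monomial]
    have : (i:ℝ) + 1 ≠ 0 := by positivity
    simp [this]

/-- class (C4) is unisolvent. If a polynomial of degree at most `d − 1`
has vanishing integral over each of the `d` translates `[α + ξ_i, β + ξ_i]` of a
fixed segment `[α, β]` by pairwise distinct shifts `ξ_1, …, ξ_d`, then it is the
zero polynomial. -/
theorem stmt_6 (d : ℕ) (hd : 1 ≤ d) (α β : ℝ) (hab : α < β)
    (ξ : Fin d → ℝ) (hξ : Function.Injective ξ)
    (p : Polynomial ℝ) (hp : p.natDegree ≤ d - 1)
    (h : ∀ i : Fin d, ∫ x in (α + ξ i)..(β + ξ i), p.eval x = 0) :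
    p = 0 := by
  obtain ⟨P, hPd, hP⟩ := exists_antideriv d p (by omega)
  by_cases hP0 : P = 0
  · simp [← hP, hP0]
  have hint : ∀ a b : ℝ, ∫ x in a..b, p.eval x = P.eval b - P.eval a := by
    intro a b
    apply intervalIntegral.integral_eq_sub_of_hasDerivAt
    · intro x _
      rw [← hP]
      exact P.hasDerivAt x
    · exact p.continuous.intervalIntegrable _ _
  have hq : Polynomial.taylor β P - Polynomial.taylor α P = 0 := by
    have hlt : (Polynomial.taylor β P - Polynomial.taylor α P).degree < d := by
      refine lt_of_lt_of_le (Polynomial.degree_sub_lt ?_ ?_ ?_) (?_ : (Polynomial.taylor β P).degree ≤ d)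
      · simp
      · simpa using hP0
      · simp
      · rw [Polynomial.degree_taylor]
        exact Polynomial.natDegree_le_iff_degree_le.1 hPd
    refine Polynomial.eq_zero_of_degree_lt_of_eval_finset_eq_zero (Finset.univ.image ξ) ?_ ?_
    · rw [Finset.card_image_of_injective _ hξ]
      simpa using hlt
    · intro x hx
      obtain ⟨i, -, rfl⟩ := Finset.mem_image.1 hx
      have := h i
      rw [hint] at this
      simpa [Polynomial.taylor_eval, add_comm] using this
  have hper : ∀ x, P.eval (x + β) = P.eval (x + α) := by
    intro x
    have := congrArg (Polynomial.eval x) hq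
    simp only [Polynomial.eval_sub, Polynomial.taylor_eval, Polynomial.eval_zero] at this
    first | linarith | (rw [add_comm x, add_comm x]; linarith)
  have hn : ∀ n : ℕ, P.eval (n * (β - α)) = P.eval 0 := by
    intro n
    induction n with
    | zero => simp
    | succ n ih =>
      have := hper (n * (β - α) - α)
      rw [← ih]
      convert this using 2 <;> push_cast <;> ring
  have hc : P = Polynomial.C (P.eval 0) := by
    apply Polynomial.eq_of_infinite_eval_eq
    refine (Set.infinite_range_of_injective (f := fun n : ℕ => (n:ℝ) * (β - α)) ?_).mono ?_
    · intro a b hh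
      have : β - α ≠ 0 := by linarith
      exact_mod_cast mul_right_cancel₀ this hh
    · rintro _ ⟨n, rfl⟩
      simp [hn n]
  rw [← hP, hc, Polynomial.derivative_C]
end

section
/- For each integer d ≥ 1, let α_i^{(d)} < β_i^{(d)} (i = 1,…,d) be reals, set β*_d := max_{1≤i≤d} β_i^{(d)}, and let V_d be the d×d matrix with entries [V_d]_{i,j} = ((β_i^{(d)})^j − (α_i^{(d)})^j)/j. Assume: (i) β*_d > 0 and α_i^{(d)} ≥ −β*_d for all i and d; (ii) β*_d → 1 as d → ∞; (iii) each V_d is invertible; (iv) there is c > 0 independent of d with max_{1≤i≤d} (β_i^{(d)} − α_i^{(d)}) ≥ c for all d. Then for every ε ∈ (0,1) there exists D such that for all d ≥ D, ‖V_d‖₂ · ‖V_d⁻¹‖₂ ≥ (c/√d) · (2 − ε)^{d−2}. -/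
open Real Matrix Filter

lemma aux_int (d : ℕ) (a : Fin d → ℝ) (x y M : ℝ) (hxy : x ≤ y)
    (h : ∀ t ∈ Set.Icc x y, |∑ j, a j * t ^ j.1| ≤ M) :
    |∑ j, (y ^ (j.1 + 1) - x ^ (j.1 + 1)) / (j.1 + 1) * a j| ≤ M * (y - x) := by
  have e : ∑ j, (y ^ (j.1 + 1) - x ^ (j.1 + 1)) / (j.1 + 1) * a j
      = ∫ t in x..y, ∑ j, a j * t ^ j.1 := by
    rw [intervalIntegral.integral_finsetSum]
    · refine Finset.sum_congr rfl fun j _ => ?_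
      rw [intervalIntegral.integral_const_mul, integral_pow, mul_comm]
    · intro j _
      exact (Continuous.intervalIntegrable (by fun_prop) _ _)
  rw [e]
  have := intervalIntegral.norm_integral_le_of_norm_le_const (a := x) (b := y) (C := M)
    (f := fun t => ∑ j, a j * t ^ j.1) (fun t ht => by
      rw [Set.uIoc_of_le hxy] at ht
      exact h t ⟨ht.1.le, ht.2⟩)
  rwa [abs_of_nonneg (sub_nonneg.2 hxy)] at this

lemma aux_low (d : ℕ) (A : Matrix (Fin d) (Fin d) ℝ) (i j : Fin d) :
    A i j ≤ specNorm A := by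
  have h := (Matrix.toEuclideanCLM (𝕜 := ℝ) A).le_opNorm (EuclideanSpace.single j 1)
  have h2 := PiLp.norm_apply_le (Matrix.toEuclideanCLM (𝕜 := ℝ) A (EuclideanSpace.single j 1)) i
  have h3 : (Matrix.toEuclideanCLM (𝕜 := ℝ) A (EuclideanSpace.single j 1)) i = A i j := by
    simp [Matrix.ofLp_toEuclideanCLM]
  rw [h3] at h2
  simp at h
  exact (le_abs_self _).trans (h2.trans h)

lemma aux_inv (d : ℕ) (A : Matrix (Fin d) (Fin d) ℝ) (hA : IsUnit A.det) (a : Fin d → ℝ)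
    (M : ℝ) (hM : 0 ≤ M) (h : ∀ i, |(A *ᵥ a) i| ≤ M) (j : Fin d) :
    a j ≤ specNorm A⁻¹ * (Real.sqrt d * M) := by
  have h1 := (Matrix.toEuclideanCLM (𝕜 := ℝ) A⁻¹).le_opNorm (WithLp.toLp 2 (A *ᵥ a))
  have h2 := PiLp.norm_apply_le (Matrix.toEuclideanCLM (𝕜 := ℝ) A⁻¹ (WithLp.toLp 2 (A *ᵥ a))) j
  have h3 : (Matrix.toEuclideanCLM (𝕜 := ℝ) A⁻¹ (WithLp.toLp 2 (A *ᵥ a))) j = a j := by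
    simp [Matrix.nonsing_inv_mul _ hA]
  rw [h3] at h2
  have h4 : ‖WithLp.toLp 2 (A *ᵥ a)‖ ≤ Real.sqrt d * M := by
    rw [EuclideanSpace.norm_eq]
    apply Real.sqrt_le_iff.2 ⟨by positivity, ?_⟩
    rw [mul_pow, Real.sq_sqrt (by positivity)]
    calc _ ≤ ∑ i : Fin d, M ^ 2 := Finset.sum_le_sum fun i _ => by
          have := h i
          exact pow_le_pow_left₀ (norm_nonneg _) this 2
      _ = _ := by simp
  exact (le_abs_self _).trans (h2.trans (h1.trans (mul_le_mul_of_nonneg_left h4 (norm_nonneg _))))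

lemma aux_main (n : ℕ) (α β : Fin (n+2) → ℝ) (B c : ℝ) (hab : ∀ i, α i < β i) (hB : 0 < B)
    (hβ : ∀ i, β i ≤ B) (hα : ∀ i, -B ≤ α i) (V : Matrix (Fin (n+2)) (Fin (n+2)) ℝ)
    (hV : ∀ i j, V i j = ((β i) ^ (j.1 + 1) - (α i) ^ (j.1 + 1)) / (j.1 + 1))
    (hinv : IsUnit V.det) (hc : 0 < c) (hmax : ∃ i, c ≤ β i - α i) :
    c / Real.sqrt ((n + 2 : ℕ) : ℝ) * ((2 / B) ^ n / (2 * B ^ 2)) ≤ specNorm V * specNorm V⁻¹ := by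
  set T := Polynomial.Chebyshev.T ℝ ((n + 1 : ℕ) : ℤ) with hT
  have hdeg : T.natDegree = n + 1 := by simp [hT, Polynomial.Chebyshev.natDegree_T]; try omega
  have hlc : T.coeff (n + 1) = 2 ^ n := by
    have := Polynomial.Chebyshev.leadingCoeff_T ℝ ((n + 1 : ℕ) : ℤ)
    rw [Polynomial.leadingCoeff, ← hT, hdeg] at this
    rw [this]; congr 1
  let a : Fin (n+2) → ℝ := fun j => T.coeff j.1 / B ^ j.1
  have hev : ∀ t, ∑ j, a j * t ^ j.1 = T.eval (t / B) := by
    intro t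
    rw [Polynomial.eval_eq_sum_range, hdeg, ← Fin.sum_univ_eq_sum_range (fun j => T.coeff j * (t / B) ^ j)]
    refine Finset.sum_congr rfl fun j _ => ?_
    simp only [a, div_pow]; ring
  have h1 : ∀ i, |(V *ᵥ a) i| ≤ 2 * B := by
    intro i
    have := aux_int (n+2) a (α i) (β i) 1 (hab i).le (by
      intro t ht
      rw [hev]
      apply Polynomial.Chebyshev.abs_eval_T_real_le_one
      rw [abs_div, abs_of_pos hB, div_le_one hB, abs_le]
      exact ⟨(hα i).trans ht.1, ht.2.trans (hβ i)⟩)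
    simp only [Matrix.mulVec, dotProduct, hV]
    linarith [hα i, hβ i]
  have h2 := aux_inv _ V hinv a (2 * B) (by positivity) h1 (Fin.last (n+1))
  obtain ⟨i, hi⟩ := hmax
  have h3 := aux_low _ V i 0
  rw [hV] at h3
  simp at h3
  simp only [a, Fin.val_last, hlc] at h2
  have hs : 0 < Real.sqrt ((n + 2 : ℕ) : ℝ) := Real.sqrt_pos.2 (by positivity)
  have h4 : (2 / B) ^ n / (2 * B ^ 2) / Real.sqrt ((n + 2 : ℕ) : ℝ) ≤ specNorm V⁻¹ := by
    rw [div_le_iff₀ hs, div_le_iff₀ (by positivity)]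
    calc (2 / B) ^ n = 2 ^ n / B ^ (n+1) * B := by rw [div_pow, pow_succ]; field_simp
      _ ≤ (specNorm V⁻¹ * (Real.sqrt ((n + 2 : ℕ) : ℝ) * (2 * B))) * B := by gcongr
      _ = _ := by ring
  calc _ = c * ((2 / B) ^ n / (2 * B ^ 2) / Real.sqrt ((n + 2 : ℕ) : ℝ)) := by ring
    _ ≤ _ := mul_le_mul (show c ≤ specNorm V by linarith) h4 (by positivity) (norm_nonneg _)

lemma aux_ev (B : ℕ → ℝ) (hBlim : Tendsto B atTop (nhds 1)) (ε : ℝ) (h0 : 0 < ε) (h1 : ε < 1) :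
    ∀ᶠ d in atTop, (2 - ε) ^ (d - 2) ≤ (2 / B d) ^ (d - 2) / (2 * B d ^ 2) := by
  have hl : Tendsto (fun d => 2 / B d) atTop (nhds 2) := by
    have := (tendsto_const_nhds (x := (2:ℝ))).div hBlim one_ne_zero
    rw [div_one] at this
    exact this
  have e1 := hl.eventually (lt_mem_nhds (show 2 - ε / 2 < 2 by linarith))
  have e2 := hBlim.eventually (gt_mem_nhds (show (1:ℝ) < 2 by norm_num))
  have e3 := hBlim.eventually (lt_mem_nhds (show (0:ℝ) < 1 by norm_num))
  have hr : 1 < (2 - ε / 2) / (2 - ε) := by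
    rw [one_lt_div (by linarith)]; linarith
  have e4 := ((tendsto_pow_atTop_atTop_of_one_lt hr).comp (tendsto_sub_atTop_nat 2)).eventually_ge_atTop 8
  filter_upwards [e1, e2, e3, e4] with d a1 a2 a3 a4
  simp only [Function.comp, div_pow] at a4
  have hp : 0 < (2 - ε) ^ (d - 2) := pow_pos (by linarith) _
  rw [le_div_iff₀ hp] at a4
  rw [le_div_iff₀ (by positivity)]
  have h5 : (2 - ε / 2) ^ (d - 2) ≤ (2 / B d) ^ (d - 2) :=
    pow_le_pow_left₀ (by linarith) a1.le _
  have h6 : 2 * B d ^ 2 ≤ 8 := by nlinarith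
  nlinarith

/-- extension of the exponential ill-conditioning of the monomial
basis to generic families of segments.  Here `B d = β*_d = max_i β_i^{(d)}`. -/
theorem stmt_7 (α β : ∀ d : ℕ, Fin d → ℝ)
    (hab : ∀ d : ℕ, 1 ≤ d → ∀ i : Fin d, α d i < β d i)
    (B : ℕ → ℝ)
    (hB : ∀ d : ℕ, 1 ≤ d → IsGreatest (Set.range (β d)) (B d))
    (hBpos : ∀ d : ℕ, 1 ≤ d → 0 < B d)
    (hαB : ∀ d : ℕ, 1 ≤ d → ∀ i : Fin d, -(B d) ≤ α d i)
    (hBlim : Tendsto B atTop (nhds 1))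
    (V : ∀ d : ℕ, Matrix (Fin d) (Fin d) ℝ)
    (hV : ∀ d : ℕ, ∀ i j : Fin d,
      V d i j = ((β d i) ^ (j.1 + 1) - (α d i) ^ (j.1 + 1)) / (j.1 + 1))
    (hinv : ∀ d : ℕ, 1 ≤ d → IsUnit (V d).det)
    (c : ℝ) (hc : 0 < c)
    (hmax : ∀ d : ℕ, 1 ≤ d → ∃ i : Fin d, c ≤ β d i - α d i) :
    ∀ ε : ℝ, 0 < ε → ε < 1 → ∃ D : ℕ, ∀ d : ℕ, D ≤ d →
      c / Real.sqrt d * (2 - ε) ^ ((d : ℤ) - 2)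
        ≤ specNorm (V d) * specNorm (V d)⁻¹ := by
  intro ε h0 h1
  obtain ⟨D, hD⟩ := eventually_atTop.1 (aux_ev B hBlim ε h0 h1)
  refine ⟨max D 2, fun d hd => ?_⟩
  have hd1 := hD d ((le_max_left _ _).trans hd)
  obtain ⟨n, rfl⟩ := Nat.exists_eq_add_of_le' ((le_max_right _ _).trans hd)
  have h1d : 1 ≤ n + 2 := by omega
  have hm := aux_main n (α (n+2)) (β (n+2)) (B (n+2)) c (hab _ h1d) (hBpos _ h1d)
    (fun i => (hB _ h1d).2 ⟨i, rfl⟩) (hαB _ h1d) (V (n+2)) (hV _) (hinv _ h1d) hc (hmax _ h1d)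
  refine le_trans ?_ hm
  have e : (((n + 2 : ℕ) : ℤ) - 2) = (n : ℤ) := by push_cast; ring
  rw [e, zpow_natCast]
  exact mul_le_mul_of_nonneg_left hd1 (by positivity)
end

section
/- Let d ≥ 1 and ρ ∈ ℝ, and let V = V_d(ρ) be the Chebyshev-segment Vandermonde matrix. Then VᵀV is a diagonal matrix; its diagonal entries are [VᵀV]_{i,i} = (2d/i²)·sin²(iρ) for 1 ≤ i ≤ d−1, and [VᵀV]_{d,d} = (4/d)·sin²(dρ). In particular the columns of V are pairwise orthogonal. -/
open Real Matrix Finset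

lemma aux_tel (x : ℝ) (n : ℕ) :
    2 * Real.sin x * ∑ k ∈ Finset.range n, Real.cos ((2 * (k:ℝ) + 1) * x) = Real.sin (2 * n * x) := by
  induction n with
  | zero => simp
  | succ n ih =>
    rw [Finset.sum_range_succ, mul_add, ih]
    have h1 : 2 * (n:ℝ) * x = (2 * n + 1) * x - x := by ring
    have h2 : 2 * ((n + 1 : ℕ):ℝ) * x = (2 * n + 1) * x + x := by push_cast; ring
    rw [h1, h2, Real.sin_sub, Real.sin_add]
    ring

lemma aux_zero (d : ℕ) (hd : 1 ≤ d) (m : ℤ) (hm : m ≠ 0) (h1 : m < 2 * d) (h2 : -(2 * d) < m) :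
    ∑ k ∈ Finset.range d, Real.cos ((2 * (k:ℝ) + 1) * (m * π / (2 * d))) = 0 := by
  have hd' : (d:ℝ) ≠ 0 := by positivity
  have h := aux_tel (m * π / (2 * d)) d
  have e : 2 * (d:ℝ) * (m * π / (2 * d)) = m * π := by field_simp
  rw [e, Real.sin_int_mul_pi] at h
  rcases mul_eq_zero.1 h with h | h
  · exfalso
    have hs : Real.sin (m * π / (2 * d)) = 0 := by linarith
    obtain ⟨n, hn⟩ := Real.sin_eq_zero_iff.1 hs
    have hn2 : (n:ℝ) * (2 * d) = m := by
      have hp := Real.pi_ne_zero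
      field_simp at hn
      linarith
    have hn3 : n * (2 * d) = m := by exact_mod_cast hn2
    have hdz : (1:ℤ) ≤ d := by exact_mod_cast hd
    have a1 : n < 1 := by nlinarith
    have a2 : -1 < n := by nlinarith
    have a3 : n = 0 := by omega
    subst a3
    simp at hn3
    exact hm hn3.symm
  · exact h

lemma aux_prod (d a b : ℕ) :
    ∑ k ∈ Finset.range d, Real.sin ((a:ℝ) * ((2 * k + 1) * π / (2 * d))) *
      Real.sin ((b:ℝ) * ((2 * k + 1) * π / (2 * d))) =
    (∑ k ∈ Finset.range d, Real.cos ((2 * (k:ℝ) + 1) * ((((a:ℤ) - b : ℤ) : ℝ) * π / (2 * d))) -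
     ∑ k ∈ Finset.range d, Real.cos ((2 * (k:ℝ) + 1) * ((((a:ℤ) + b : ℤ) : ℝ) * π / (2 * d)))) / 2 := by
  rw [← Finset.sum_sub_distrib, Finset.sum_div]
  refine Finset.sum_congr rfl fun k _ => ?_
  have h1 : (2 * (k:ℝ) + 1) * ((((a:ℤ) - b : ℤ) : ℝ) * π / (2 * d)) =
    (a:ℝ) * ((2 * k + 1) * π / (2 * d)) - (b:ℝ) * ((2 * k + 1) * π / (2 * d)) := by
    push_cast; ring
  have h2 : (2 * (k:ℝ) + 1) * ((((a:ℤ) + b : ℤ) : ℝ) * π / (2 * d)) =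
    (a:ℝ) * ((2 * k + 1) * π / (2 * d)) + (b:ℝ) * ((2 * k + 1) * π / (2 * d)) := by
    push_cast; ring
  rw [h1, h2, Real.cos_sub, Real.cos_add]
  ring

/-- the Chebyshev-segment Vandermonde matrix
`V k j = (2/j) sin(j τ_k) sin(j ρ)` with `τ_k = (2k−1)π/(2d)` has `VᵀV` diagonal,
with `[VᵀV]_{i,i} = (2d/i²) sin²(iρ)` for `1 ≤ i ≤ d−1` and
`[VᵀV]_{d,d} = (4/d) sin²(dρ)`; in particular the columns of `V` are pairwise
orthogonal. -/
theorem stmt_8 (d : ℕ) (hd : 1 ≤ d) (ρ : ℝ)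
    (V : Matrix (Fin d) (Fin d) ℝ)
    (hV : ∀ k j : Fin d,
      V k j = 2 / (j.1 + 1) * Real.sin ((j.1 + 1) * ((2 * k.1 + 1) * π / (2 * d)))
        * Real.sin ((j.1 + 1) * ρ)) :
    (Vᵀ * V).IsDiag ∧
      (∀ i : Fin d, i.1 + 1 < d →
        (Vᵀ * V) i i = 2 * d / ((i.1 + 1 : ℝ) ^ 2) * Real.sin ((i.1 + 1) * ρ) ^ 2) ∧
      (Vᵀ * V) ⟨d - 1, by omega⟩ ⟨d - 1, by omega⟩ = 4 / d * Real.sin (d * ρ) ^ 2 ∧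
      (∀ j k : Fin d, j ≠ k → ∑ i : Fin d, V i j * V i k = 0) := by
  have hd' : (d:ℝ) ≠ 0 := by positivity
  have key : ∀ i j : Fin d, ∑ k : Fin d, V k i * V k j =
      (2 / ((i.1:ℝ) + 1) * Real.sin ((i.1 + 1) * ρ)) * (2 / ((j.1:ℝ) + 1) * Real.sin ((j.1 + 1) * ρ)) *
      ∑ k ∈ Finset.range d, Real.sin (((i.1 + 1 : ℕ):ℝ) * ((2 * k + 1) * π / (2 * d))) *
        Real.sin (((j.1 + 1 : ℕ):ℝ) * ((2 * k + 1) * π / (2 * d))) := by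
    intro i j
    rw [Finset.sum_range, Finset.mul_sum]
    refine Finset.sum_congr rfl fun k _ => ?_
    rw [hV, hV]
    push_cast
    ring
  have orth : ∀ j k : Fin d, j ≠ k → ∑ i : Fin d, V i j * V i k = 0 := by
    intro i j hij
    have hij' : i.1 ≠ j.1 := fun h => hij (Fin.ext h)
    have hi := i.2
    have hj := j.2
    rw [key, aux_prod, aux_zero d hd _ (by omega) (by omega) (by omega),
      aux_zero d hd _ (by omega) (by omega) (by omega)]
    simp
  have ent : ∀ i j : Fin d, (Vᵀ * V) i j = ∑ k : Fin d, V k i * V k j := fun i j => by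
    simp [Matrix.mul_apply]
  refine ⟨fun i j hij => ?_, fun i hi => ?_, ?_, orth⟩
  · exact (ent i j).trans (orth i j hij)
  · rw [ent, key, aux_prod, aux_zero d hd (((i.1 + 1 : ℕ):ℤ) + ((i.1 + 1 : ℕ):ℤ))
      (by omega) (by omega) (by omega)]
    have hi' : (i.1:ℝ) + 1 ≠ 0 := by positivity
    simp
    field_simp
  · rw [ent, key, aux_prod]
    have e : ((d - 1 : ℕ) : ℝ) + 1 = d := by
      rw [Nat.cast_sub hd]; simp
    have e2 : d - 1 + 1 = d := by omega
    simp only [e, e2]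
    have hc : ∀ k ∈ Finset.range d,
        Real.cos ((2 * (k:ℝ) + 1) * ((((d:ℤ) + d : ℤ) : ℝ) * π / (2 * d))) = -1 := by
      intro k _
      have h : (2 * (k:ℝ) + 1) * ((((d:ℤ) + d : ℤ) : ℝ) * π / (2 * d)) = π + k * (2 * π) := by
        push_cast; field_simp; ring
      rw [h, Real.cos_add_nat_mul_two_pi, Real.cos_pi]
    rw [Finset.sum_congr rfl hc]
    simp
    field_simp
    ring
end

section
/- For each integer d ≥ 2, let V_d = V_d(π/(2d)) be the Chebyshev-segment Vandermonde matrix with arc parameter ρ = π/(2d). Then each V_d is invertible, and the spectral condition numbers converge: lim_{d→∞} ‖V_d‖₂ · ‖V_d⁻¹‖₂ = π/2. -/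
open Real Matrix Filter

lemma aux_normsq {d : ℕ} (A : Matrix (Fin d) (Fin d) ℝ) (g : Fin d → ℝ)
    (h : Aᵀ * A = Matrix.diagonal g) (x : EuclideanSpace ℝ (Fin d)) :
    ‖Matrix.toEuclideanCLM (𝕜 := ℝ) A x‖ ^ 2 = ∑ j, g j * x j ^ 2 := by
  rw [EuclideanSpace.norm_sq_eq]
  have h1 : ∀ i, (Matrix.toEuclideanCLM (𝕜 := ℝ) A x) i = (A *ᵥ (WithLp.ofLp x)) i := by
    intro i
    rw [← Matrix.ofLp_toEuclideanCLM]
  simp only [h1, Real.norm_eq_abs, sq_abs]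
  have h2 : (A *ᵥ WithLp.ofLp x) ⬝ᵥ (A *ᵥ WithLp.ofLp x)
      = WithLp.ofLp x ⬝ᵥ ((Aᵀ * A) *ᵥ WithLp.ofLp x) := by
    rw [← Matrix.mulVec_mulVec, Matrix.dotProduct_mulVec (WithLp.ofLp x), Matrix.vecMul_transpose]
  rw [h] at h2
  simp only [dotProduct, Matrix.mulVec_diagonal] at h2
  calc _ = ∑ i, (A *ᵥ WithLp.ofLp x) i * (A *ᵥ WithLp.ofLp x) i := by
        simp only [sq]
    _ = _ := by
        rw [h2]
        exact Finset.sum_congr rfl fun i _ => by ring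

lemma aux_det_s11 {d : ℕ} (A : Matrix (Fin d) (Fin d) ℝ) (g : Fin d → ℝ)
    (h : Aᵀ * A = Matrix.diagonal g) (hg : ∀ j, 0 < g j) : IsUnit A.det := by
  have h1 := congrArg Matrix.det h
  rw [Matrix.det_mul, Matrix.det_transpose, Matrix.det_diagonal] at h1
  have h2 : 0 < ∏ i, g i := Finset.prod_pos fun i _ => hg i
  rw [isUnit_iff_ne_zero]
  intro h0
  rw [h0] at h1
  simp at h1
  linarith

lemma aux_upper {d : ℕ} (A : Matrix (Fin d) (Fin d) ℝ) (g : Fin d → ℝ)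
    (h : Aᵀ * A = Matrix.diagonal g) (M : ℝ) (hM : 0 ≤ M) (hg : ∀ j, g j ≤ M ^ 2) :
    specNorm A ≤ M := by
  refine ContinuousLinearMap.opNorm_le_bound _ hM fun x => ?_
  refine le_of_sq_le_sq ?_ (by positivity)
  rw [aux_normsq A g h, mul_pow, EuclideanSpace.norm_sq_eq, Finset.mul_sum]
  refine Finset.sum_le_sum fun i _ => ?_
  rw [Real.norm_eq_abs, sq_abs]
  exact mul_le_mul_of_nonneg_right (hg i) (sq_nonneg _)

lemma aux_inv_s11 {d : ℕ} (A : Matrix (Fin d) (Fin d) ℝ) (hA : IsUnit A.det)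
    (x : EuclideanSpace ℝ (Fin d)) :
    Matrix.toEuclideanCLM (𝕜 := ℝ) A (Matrix.toEuclideanCLM (𝕜 := ℝ) A⁻¹ x) = x ∧
    Matrix.toEuclideanCLM (𝕜 := ℝ) A⁻¹ (Matrix.toEuclideanCLM (𝕜 := ℝ) A x) = x := by
  constructor
  · rw [← mul_apply_eq_comp, ← map_mul, Matrix.mul_nonsing_inv _ hA, map_one]; rfl
  · rw [← mul_apply_eq_comp, ← map_mul, Matrix.nonsing_inv_mul _ hA, map_one]; rfl

lemma aux_inv_upper {d : ℕ} (A : Matrix (Fin d) (Fin d) ℝ) (g : Fin d → ℝ)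
    (h : Aᵀ * A = Matrix.diagonal g) (hA : IsUnit A.det)
    (m : ℝ) (hm : 0 < m) (hg : ∀ j, m ^ 2 ≤ g j) :
    specNorm A⁻¹ ≤ m⁻¹ := by
  refine ContinuousLinearMap.opNorm_le_bound _ (by positivity) fun x => ?_
  set y := Matrix.toEuclideanCLM (𝕜 := ℝ) A⁻¹ x with hy
  have hx : Matrix.toEuclideanCLM (𝕜 := ℝ) A y = x := (aux_inv_s11 A hA x).1
  have key : m * ‖y‖ ≤ ‖x‖ := by
    refine le_of_sq_le_sq ?_ (by positivity)
    rw [← hx, aux_normsq A g h, mul_pow, EuclideanSpace.norm_sq_eq, Finset.mul_sum]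
    refine Finset.sum_le_sum fun i _ => ?_
    rw [Real.norm_eq_abs, sq_abs]
    exact mul_le_mul_of_nonneg_right (hg i) (sq_nonneg _)
  rw [inv_mul_eq_div, le_div_iff₀ hm]
  linarith

lemma aux_single {d : ℕ} (A : Matrix (Fin d) (Fin d) ℝ) (g : Fin d → ℝ)
    (h : Aᵀ * A = Matrix.diagonal g) (i : Fin d) :
    ‖Matrix.toEuclideanCLM (𝕜 := ℝ) A (EuclideanSpace.single i 1)‖ = √(g i) := by
  rw [← Real.sqrt_sq (norm_nonneg _), aux_normsq A g h]
  congr 1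
  rw [Finset.sum_eq_single i]
  · simp
  · intro b _ hb
    simp [hb]
  · simp

lemma aux_lower {d : ℕ} (A : Matrix (Fin d) (Fin d) ℝ) (g : Fin d → ℝ)
    (h : Aᵀ * A = Matrix.diagonal g) (i : Fin d) : √(g i) ≤ specNorm A := by
  rw [← aux_single A g h i]
  have := ContinuousLinearMap.le_opNorm (Matrix.toEuclideanCLM (𝕜 := ℝ) A)
    (EuclideanSpace.single i 1)
  simpa [specNorm] using this

lemma aux_inv_lower {d : ℕ} (A : Matrix (Fin d) (Fin d) ℝ) (g : Fin d → ℝ)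
    (h : Aᵀ * A = Matrix.diagonal g) (hA : IsUnit A.det) (i : Fin d) :
    1 ≤ specNorm A⁻¹ * √(g i) := by
  rw [← aux_single A g h i]
  have := ContinuousLinearMap.le_opNorm (Matrix.toEuclideanCLM (𝕜 := ℝ) A⁻¹)
    (Matrix.toEuclideanCLM (𝕜 := ℝ) A (EuclideanSpace.single i 1))
  rw [(aux_inv_s11 A hA _).2] at this
  simpa [specNorm] using this

lemma aux_cos_sum (d : ℕ) (t : ℝ) :
    (∑ k ∈ Finset.range d, cos ((2 * k + 1) * t)) * (2 * sin t) = sin (2 * d * t) := by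
  induction d with
  | zero => simp
  | succ n ih =>
    rw [Finset.sum_range_succ, add_mul, ih]
    have e1 : (2 * ((n + 1 : ℕ) : ℝ) * t) = (2 * n + 1) * t + t := by push_cast; ring
    have e2 : (2 * (n : ℝ) * t) = (2 * n + 1) * t - t := by ring
    rw [e1, e2, sin_add, sin_sub]; ring

lemma aux_cos_zero (d : ℕ) (m : ℤ) (h1 : m ≠ 0) (h2 : |m| < 2 * d) :
    ∑ k ∈ Finset.range d, cos ((2 * k + 1) * (m * (π / (2 * d)))) = 0 := by
  have hd : (0 : ℝ) < d := by
    have : (0:ℤ) < d := by have := abs_nonneg m; omega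
    exact_mod_cast this
  have h := aux_cos_sum d (m * (π / (2 * d)))
  have e : 2 * (d:ℝ) * (m * (π / (2 * d))) = m * π := by field_simp
  rw [e, sin_int_mul_pi] at h
  rcases mul_eq_zero.1 h with h | h
  · exact h
  · exfalso
    have hs : sin (m * (π / (2 * d))) = 0 := by linarith
    obtain ⟨n, hn⟩ := Real.sin_eq_zero_iff.1 hs
    have h3 : (n : ℝ) * (2 * d) = m := by
      have := pi_pos
      field_simp at hn
      nlinarith
    have h4 : n * (2 * d) = m := by exact_mod_cast h3
    have h5 : (2 * (d:ℤ)) ∣ m := ⟨n, by rw [← h4]; ring⟩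
    exact h1 (Int.eq_zero_of_abs_lt_dvd h5 h2)

lemma aux_gram (d : ℕ) (hd : 2 ≤ d) (j l : Fin d) :
    ∑ k : Fin d, sin ((j.1 + 1) * ((2 * k.1 + 1) * π / (2 * d)))
      * sin ((l.1 + 1) * ((2 * k.1 + 1) * π / (2 * d)))
      = if j = l then (if j.1 + 1 = d then (d:ℝ) else d / 2) else 0 := by
  rw [Fin.sum_univ_eq_sum_range (fun k : ℕ => sin ((j.1 + 1) * ((2 * (k:ℝ) + 1) * π / (2 * d)))
      * sin ((l.1 + 1) * ((2 * (k:ℝ) + 1) * π / (2 * d)))) d]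
  have hd0 : (d : ℝ) ≠ 0 := by positivity
  have hj := j.2
  have hl := l.2
  have e : ∀ k ∈ Finset.range d, sin ((j.1 + 1) * ((2 * (k:ℝ) + 1) * π / (2 * d)))
      * sin ((l.1 + 1) * ((2 * (k:ℝ) + 1) * π / (2 * d)))
      = 1 / 2 * cos ((2 * k + 1) * ((((j.1:ℤ) - l.1 : ℤ) : ℝ) * (π / (2 * d))))
      - 1 / 2 * cos ((2 * k + 1) * ((((j.1:ℤ) + l.1 + 2 : ℤ) : ℝ) * (π / (2 * d)))) := by
    intro k _
    have e1 : (2 * (k:ℝ) + 1) * ((((j.1:ℤ) - l.1 : ℤ) : ℝ) * (π / (2 * d)))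
      = ((j.1 + 1) * ((2 * (k:ℝ) + 1) * π / (2 * d))) - ((l.1 + 1) * ((2 * (k:ℝ) + 1) * π / (2 * d))) := by
      push_cast; ring
    have e2 : (2 * (k:ℝ) + 1) * ((((j.1:ℤ) + l.1 + 2 : ℤ) : ℝ) * (π / (2 * d)))
      = ((j.1 + 1) * ((2 * (k:ℝ) + 1) * π / (2 * d))) + ((l.1 + 1) * ((2 * (k:ℝ) + 1) * π / (2 * d))) := by
      push_cast; ring
    rw [e1, e2, cos_add, cos_sub]; ring
  rw [Finset.sum_congr rfl e, Finset.sum_sub_distrib, ← Finset.mul_sum, ← Finset.mul_sum]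
  split_ifs with h1 h2
  · subst h1
    have : (((j.1:ℤ) + j.1 + 2 : ℤ) : ℝ) * (π / (2 * d)) = π := by
      have : (((j.1:ℤ) + j.1 + 2 : ℤ) : ℝ) = 2 * d := by
        have : ((j.1:ℤ) + j.1 + 2 : ℤ) = 2 * d := by omega
        rw [this]; push_cast; ring
      rw [this]; field_simp
    rw [this]
    have e3 : ∀ k ∈ Finset.range d, cos ((2 * (k:ℝ) + 1) * π) = -1 := by
      intro k _
      rw [show (2 * (k:ℝ) + 1) * π = π + k * (2 * π) by ring, cos_add_nat_mul_two_pi, cos_pi]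
    rw [Finset.sum_congr rfl e3]
    simp
    ring
  · subst h1
    rw [aux_cos_zero d ((j.1:ℤ) + j.1 + 2) (by omega) (by rw [abs_of_nonneg] <;> omega)]
    simp
    ring
  · have h1' : j.1 ≠ l.1 := fun h => h1 (Fin.ext h)
    rw [aux_cos_zero d ((j.1:ℤ) + l.1 + 2) (by omega) (by rw [abs_of_nonneg] <;> omega),
      aux_cos_zero d ((j.1:ℤ) - l.1) (by omega) (by rw [abs_lt]; constructor <;> omega)]
    simp

/-- Squared singular values. -/
noncomputable def auxG (d : ℕ) (j : Fin d) : ℝ :=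
  (2 / (j.1 + 1) * sin ((j.1 + 1) * (π / (2 * d)))) ^ 2 * (if j.1 + 1 = d then (d:ℝ) else d / 2)

lemma aux_VtV (d : ℕ) (hd : 2 ≤ d) (V : Matrix (Fin d) (Fin d) ℝ)
    (hV : ∀ k j : Fin d, V k j = 2 / (j.1 + 1)
        * Real.sin ((j.1 + 1) * ((2 * k.1 + 1) * π / (2 * d)))
        * Real.sin ((j.1 + 1) * (π / (2 * d)))) :
    Vᵀ * V = Matrix.diagonal (auxG d) := by
  ext j l
  rw [Matrix.mul_apply, Matrix.diagonal_apply]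
  simp only [Matrix.transpose_apply, hV]
  have := aux_gram d hd j l
  calc _ = (2 / (j.1 + 1) * sin ((j.1 + 1) * (π / (2 * d))))
        * (2 / (l.1 + 1) * sin ((l.1 + 1) * (π / (2 * d)))) *
        ∑ k : Fin d, sin ((j.1 + 1) * ((2 * k.1 + 1) * π / (2 * d)))
      * sin ((l.1 + 1) * ((2 * k.1 + 1) * π / (2 * d))) := by
        rw [Finset.mul_sum]
        exact Finset.sum_congr rfl fun k _ => by ring
    _ = _ := by
        rw [this]
        by_cases h : j = l
        · subst h
          simp only [if_true, auxG]; ring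
        · simp [h]

lemma auxG_bounds (d : ℕ) (hd : 2 ≤ d) (j : Fin d) :
    2 / (d:ℝ) ≤ auxG d j ∧ auxG d j ≤ π ^ 2 / (2 * d) := by
  have hd0 : (0 : ℝ) < d := by positivity
  have hp := pi_gt_three
  have hj : (j.1 : ℝ) + 1 ≤ d := by exact_mod_cast j.2
  have hj0 : (0 : ℝ) < (j.1 : ℝ) + 1 := by positivity
  unfold auxG
  set n : ℝ := (j.1 : ℝ) + 1 with hn
  split_ifs with h
  · have hnd : n = d := by rw [hn]; exact_mod_cast h
    have : n * (π / (2 * d)) = π / 2 := by rw [hnd]; field_simp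
    rw [this, sin_pi_div_two, hnd]
    have : (2 / (d:ℝ) * 1) ^ 2 * d = 4 / d := by field_simp; norm_num
    rw [this]
    constructor
    · gcongr; norm_num
    · rw [div_le_div_iff₀ hd0 (by positivity)]
      nlinarith [mul_pos hd0 pi_pos]
  · have hx0 : 0 ≤ n * (π / (2 * d)) := by positivity
    have hx1 : n * (π / (2 * d)) ≤ π / 2 := by
      rw [← mul_div_assoc, div_le_div_iff₀ (by positivity) (by norm_num)]
      nlinarith
    have hlo : 2 / (d:ℝ) ≤ 2 / n * sin (n * (π / (2 * d))) := by
      calc 2 / (d:ℝ) = 2 / n * (2 / π * (n * (π / (2 * d)))) := by field_simp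
        _ ≤ _ := by
          gcongr
          exact Real.mul_le_sin hx0 hx1
    have hup : 2 / n * sin (n * (π / (2 * d))) ≤ π / d := by
      calc _ ≤ 2 / n * (n * (π / (2 * d))) := by
            gcongr
            exact Real.sin_le hx0
        _ = _ := by field_simp
    have hpos : 0 ≤ 2 / (d:ℝ) := by positivity
    constructor
    · calc 2 / (d:ℝ) = (2 / (d:ℝ)) ^ 2 * (d / 2) := by field_simp
        _ ≤ _ := by gcongr
    · calc _ ≤ (π / (d:ℝ)) ^ 2 * (d / 2) := by
            have := hpos.trans hlo
            gcongr
        _ = _ := by field_simp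

lemma aux_lim : Tendsto (fun d : ℕ => ((d:ℝ) - 1) * sin (π / (2 * d))) atTop (nhds (π / 2)) := by
  have h0 : Tendsto (fun d : ℕ => π / (2 * (d:ℝ))) atTop (nhds 0) :=
    tendsto_const_nhds.div_atTop (tendsto_natCast_atTop_atTop.const_mul_atTop (by norm_num))
  have h1 : Tendsto (fun d : ℕ => sinc (π / (2 * (d:ℝ)))) atTop (nhds 1) := by
    have := (continuous_sinc.tendsto 0).comp h0
    simpa [Function.comp_def] using this
  have h2 : Tendsto (fun d : ℕ => sin (π / (2 * (d:ℝ)))) atTop (nhds 0) := by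
    have := (continuous_sin.tendsto 0).comp h0
    simpa [Function.comp_def] using this
  have h3 := (h1.const_mul (π / 2)).sub h2
  simp only [mul_one, sub_zero] at h3
  refine h3.congr' ?_
  filter_upwards [eventually_ge_atTop 1] with d hd
  have hd0 : (0 : ℝ) < d := by exact_mod_cast hd
  have := pi_pos
  rw [sinc_of_ne_zero (by positivity)]
  field_simp

theorem stmt_11 (V : ∀ d : ℕ, Matrix (Fin d) (Fin d) ℝ)
    (hV : ∀ d : ℕ, 2 ≤ d → ∀ k j : Fin d,
      V d k j = 2 / (j.1 + 1)
        * Real.sin ((j.1 + 1) * ((2 * k.1 + 1) * π / (2 * d)))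
        * Real.sin ((j.1 + 1) * (π / (2 * d)))) :
    (∀ d : ℕ, 2 ≤ d → IsUnit (V d).det) ∧
      Tendsto (fun d : ℕ => specNorm (V d) * specNorm (V d)⁻¹)
        atTop (nhds (π / 2)) := by
  have hG := fun d hd => aux_VtV d hd (V d) (hV d hd)
  have hU : ∀ d : ℕ, 2 ≤ d → IsUnit (V d).det := fun d hd =>
    aux_det_s11 _ _ (hG d hd) fun j =>
      lt_of_lt_of_le (by positivity) (auxG_bounds d hd j).1
  refine ⟨hU, tendsto_of_tendsto_of_tendsto_of_le_of_le' aux_lim tendsto_const_nhds ?_ ?_⟩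
  · filter_upwards [eventually_ge_atTop 3] with d hd3
    have hd : 2 ≤ d := by omega
    have hd0 : (0 : ℝ) < d := by positivity
    have hd1 : (0 : ℝ) < (d:ℝ) - 1 := by
      have : (3:ℝ) ≤ d := by exact_mod_cast hd3
      linarith
    have hs : (0:ℝ) < √(d / 2) := by positivity
    have a1 := aux_lower _ _ (hG d hd) ⟨0, by omega⟩
    have a2 := aux_inv_lower _ _ (hG d hd) (hU d hd) ⟨d - 2, by omega⟩
    have hsin : 0 ≤ sin (π / (2 * d)) := by
      apply sin_nonneg_of_nonneg_of_le_pi (by positivity)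
      apply div_le_self pi_pos.le
      have : (3:ℝ) ≤ d := by exact_mod_cast hd3
      linarith
    have g1 : √(auxG d ⟨0, by omega⟩) = 2 * sin (π / (2 * d)) * √(d / 2) := by
      unfold auxG
      rw [if_neg (by simp; omega), Real.sqrt_mul (sq_nonneg _)]
      simp only [Nat.cast_zero, zero_add, one_mul, div_one]
      rw [Real.sqrt_sq (by positivity)]
    have g2 : √(auxG d ⟨d - 2, by omega⟩) ≤ 2 / ((d:ℝ) - 1) * √(d / 2) := by
      unfold auxG
      rw [if_neg (by simp; omega), Real.sqrt_mul (sq_nonneg _), Real.sqrt_sq_eq_abs]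
      have e : (((d - 2 : ℕ) : ℝ) + 1) = (d:ℝ) - 1 := by
        rw [Nat.cast_sub hd]; push_cast; ring
      simp only [e]
      gcongr
      rw [abs_mul, abs_of_pos (by positivity : 0 < 2 / ((d:ℝ) - 1))]
      exact mul_le_of_le_one_right (by positivity) (abs_sin_le_one _)
    rw [g1] at a1
    have hn : 0 ≤ specNorm (V d)⁻¹ := norm_nonneg _
    have a3 : 1 ≤ specNorm (V d)⁻¹ * (2 / ((d:ℝ) - 1) * √(d / 2)) :=
      a2.trans (mul_le_mul_of_nonneg_left g2 hn)
    calc ((d:ℝ) - 1) * sin (π / (2 * d)) 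
        ≤ (((d:ℝ) - 1) * sin (π / (2 * d))) * (specNorm (V d)⁻¹ * (2 / ((d:ℝ) - 1) * √(d / 2))) :=
          le_mul_of_one_le_right (by positivity) a3
      _ = (2 * sin (π / (2 * d)) * √(d / 2)) * specNorm (V d)⁻¹ := by field_simp
      _ ≤ _ := mul_le_mul_of_nonneg_right a1 hn
  · filter_upwards [eventually_ge_atTop 2] with d hd
    have hd0 : (0 : ℝ) < d := by positivity
    have hs : (0:ℝ) < √(2 / d) := by positivity
    have b2 := aux_inv_upper _ _ (hG d hd) (hU d hd) (√(2 / d)) hs (fun j => by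
      rw [Real.sq_sqrt (by positivity)]; exact (auxG_bounds d hd j).1)
    have b1 := aux_upper _ _ (hG d hd) (π / 2 * √(2 / d)) (by positivity) (fun j => by
      rw [mul_pow, Real.sq_sqrt (by positivity)]
      refine (auxG_bounds d hd j).2.trans (le_of_eq ?_)
      field_simp)
    calc _ ≤ (π / 2 * √(2 / d)) * (√(2 / d))⁻¹ :=
          mul_le_mul b1 b2 (norm_nonneg _) (by positivity)
      _ = π / 2 := by field_simp
end

section
/- Let 0 < a ≤ π/2 and, for each integer d ≥ 1, let V_d = V_d(a/d) be the Chebyshev-segment Vandermonde matrix with arc parameter ρ = a/d. Then the Frobenius norms converge: lim_{d→∞} ‖V_d‖_F = √(2a·Si(2a) + cos(2a) − 1), where Si(z) = ∫₀^z (sin t)/t dt is the sine integral. -/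
open Real Matrix Filter

/-- The Frobenius norm of a real `d × d` matrix. -/
noncomputable def frobNorm {d : ℕ} (A : Matrix (Fin d) (Fin d) ℝ) : ℝ :=
  Real.sqrt (∑ i : Fin d, ∑ j : Fin d, (A i j) ^ 2)

/-- The sine integral `Si(z) = ∫₀^z sin t / t dt`. -/
noncomputable def Si (z : ℝ) : ℝ := ∫ t in (0 : ℝ)..z, Real.sin t / t

lemma riemann_aux (f : ℝ → ℝ) (hf : Continuous f) :
    Tendsto (fun d : ℕ => (1 / (d:ℝ)) * ∑ j ∈ Finset.range d, f (((j:ℝ)+1)/d)) atTop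
      (nhds (∫ x in (0:ℝ)..1, f x)) := by
  have huc : UniformContinuousOn f (Set.Icc 0 1) :=
    isCompact_Icc.uniformContinuousOn_of_continuous hf.continuousOn
  rw [Metric.uniformContinuousOn_iff] at huc
  rw [Metric.tendsto_atTop]
  intro ε hε
  obtain ⟨δ, hδ, h⟩ := huc (ε/2) (by positivity)
  obtain ⟨N, hN⟩ := exists_nat_gt (1/δ)
  refine ⟨N+1, fun d hd => ?_⟩
  have hdN : (N:ℝ) + 1 ≤ d := by exact_mod_cast hd
  have hN0 : (0:ℝ) ≤ N := Nat.cast_nonneg N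
  have hd0 : (0:ℝ) < d := by linarith
  have hdδ : 1 / (d:ℝ) < δ := by
    rw [div_lt_iff₀ hd0]
    rw [div_lt_iff₀ hδ] at hN
    nlinarith
  have hs := intervalIntegral.sum_integral_adjacent_intervals (f := f) (μ := MeasureTheory.volume)
    (a := fun k : ℕ => (k:ℝ)/d) (n := d) (fun k _ => hf.intervalIntegrable _ _)
  simp only [Nat.cast_zero, zero_div, div_self hd0.ne'] at hs
  rw [← hs, Real.dist_eq, Finset.mul_sum, ← Finset.sum_sub_distrib]
  have key : ∀ j ∈ Finset.range d,
      |1 / (d:ℝ) * f (((j:ℝ)+1)/d) - ∫ x in ((j:ℝ)/d)..(((j+1:ℕ):ℝ)/d), f x| ≤ (ε/2) * (1/d) := by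
    intro j hj
    have hjd : (j:ℝ) + 1 ≤ d := by exact_mod_cast Finset.mem_range.mp hj
    have hj0 : (0:ℝ) ≤ j := Nat.cast_nonneg j
    have hlen : ((j:ℝ)+1)/d - (j:ℝ)/d = 1/d := by ring
    push_cast
    have e : 1 / (d:ℝ) * f (((j:ℝ)+1)/d) - ∫ x in ((j:ℝ)/d)..(((j:ℝ)+1)/d), f x
        = ∫ x in ((j:ℝ)/d)..(((j:ℝ)+1)/d), (f (((j:ℝ)+1)/d) - f x) := by
      rw [intervalIntegral.integral_sub (by simp) (hf.intervalIntegrable _ _),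
        intervalIntegral.integral_const, hlen, smul_eq_mul]
    rw [e]
    have hle : (j:ℝ)/d ≤ ((j:ℝ)+1)/d := by gcongr; linarith
    have := intervalIntegral.norm_integral_le_of_norm_le_const (C := ε/2)
      (f := fun x => f (((j:ℝ)+1)/d) - f x) (a := (j:ℝ)/d) (b := ((j:ℝ)+1)/d) (by
        intro x hx
        rw [Set.uIoc_of_le hle] at hx
        have h1 : ((j:ℝ)+1)/d ≤ 1 := by rw [div_le_one hd0]; exact hjd
        have h0 : 0 ≤ (j:ℝ)/d := by positivity
        have := h (((j:ℝ)+1)/d) ⟨by linarith [hx.1, hx.2], h1⟩ x ⟨by linarith [hx.1], by linarith [hx.2]⟩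
          (by rw [Real.dist_eq, abs_lt]; constructor <;> linarith [hx.1, hx.2])
        rw [Real.dist_eq] at this
        exact this.le)
    rw [hlen, Real.norm_eq_abs, abs_of_pos (by positivity : 0 < 1/(d:ℝ))] at this
    exact this
  calc _ ≤ ∑ j ∈ Finset.range d, (ε/2) * (1/(d:ℝ)) :=
        (Finset.abs_sum_le_sum_abs _ _).trans (Finset.sum_le_sum key)
    _ = ε/2 := by simp; field_simp
    _ < ε := by linarith

lemma Si_eq (z : ℝ) (hz : 0 ≤ z) : Si z = ∫ t in (0:ℝ)..z, Real.sinc t := by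
  unfold Si
  apply intervalIntegral.integral_congr_ae
  refine Filter.Eventually.of_forall fun t ht => ?_
  rw [Set.uIoc_of_le hz] at ht
  rw [Real.sinc_of_ne_zero ht.1.ne']

lemma sinc_int (a : ℝ) (ha : 0 < a) :
    ∫ x in (0:ℝ)..1, 2 * a^2 * Real.sinc (a*x) ^ 2 =
      2 * a * Si (2 * a) + Real.cos (2 * a) - 1 := by
  have h1 : ∫ x in (0:ℝ)..1, 2 * a^2 * Real.sinc (a*x) ^ 2 =
      a * ∫ u in (0:ℝ)..a, 2 * Real.sinc u ^ 2 := by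
    have := intervalIntegral.mul_integral_comp_mul_left (a := 0) (b := 1) (f := fun u => 2 * Real.sinc u ^ 2) (c := a)
    simp only [mul_zero, mul_one] at this
    rw [← this, ← intervalIntegral.integral_const_mul, ← intervalIntegral.integral_const_mul]
    congr 1; ext x; ring
  have hS : ∀ z, HasDerivAt (fun z => ∫ t in (0:ℝ)..z, Real.sinc t) (Real.sinc z) z := fun z =>
    intervalIntegral.integral_hasDerivAt_right (Real.continuous_sinc.intervalIntegrable _ _)
      (Real.continuous_sinc.stronglyMeasurableAtFilter _ _) Real.continuous_sinc.continuousAt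
  have hcS : Continuous (fun z => ∫ t in (0:ℝ)..z, Real.sinc t) :=
    continuous_iff_continuousAt.2 fun z => (hS z).continuousAt
  have h2 : ∫ u in (0:ℝ)..a, 2 * Real.sinc u ^ 2 =
      (2 * (∫ t in (0:ℝ)..(2*a), Real.sinc t) - 2 * Real.sin a * Real.sinc a)
      - (2 * (∫ t in (0:ℝ)..(2*0), Real.sinc t) - 2 * Real.sin 0 * Real.sinc 0) := by
    apply intervalIntegral.integral_eq_sub_of_hasDerivAt_of_le ha.le
      (f := fun u => 2 * (∫ t in (0:ℝ)..(2*u), Real.sinc t) - 2 * Real.sin u * Real.sinc u)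
    · have := hcS.comp (continuous_const.mul continuous_id : Continuous fun u : ℝ => 2 * u)
      have h3 := Real.continuous_sinc
      exact ((continuous_const.mul this).sub
        ((continuous_const.mul Real.continuous_sin).mul h3)).continuousOn
    · intro u hu
      have hu0 : u ≠ 0 := hu.1.ne'
      have d1 : HasDerivAt (fun u => ∫ t in (0:ℝ)..(2*u), Real.sinc t) (Real.sinc (2*u) * (2 * 1)) u :=
        (hS (2*u)).comp u ((hasDerivAt_id u).const_mul 2)
      have d2 : HasDerivAt Real.sinc ((Real.cos u * u - Real.sin u * 1) / u^2) u := by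
        refine ((Real.hasDerivAt_sin u).div (hasDerivAt_id u) hu0).congr_of_eventuallyEq ?_
        filter_upwards [isOpen_ne.mem_nhds hu0] with x hx
        exact Real.sinc_of_ne_zero hx
      have d3 := (d1.const_mul 2).sub (((Real.hasDerivAt_sin u).const_mul 2).mul d2)
      refine HasDerivAt.congr_deriv (f' := _) d3 ?_
      rw [Real.sinc_of_ne_zero hu0, Real.sinc_of_ne_zero (mul_ne_zero two_ne_zero hu0),
        Real.sin_two_mul]
      field_simp
      ring
    · exact Continuous.intervalIntegrable (continuous_const.mul (Real.continuous_sinc.pow 2)) _ _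
  rw [h1, h2, Si_eq _ (by positivity), Real.sinc_of_ne_zero ha.ne', Real.cos_two_mul]
  simp
  field_simp
  have := Real.sin_sq_add_cos_sq a
  linear_combination (-2) * this

lemma sum_sin_sq (d j : ℕ) (hj : j < d) :
    ∑ k ∈ Finset.range d, Real.sin (((j:ℝ)+1) * ((2 * (k:ℝ) + 1) * π / (2 * d))) ^ 2
      = d / 2 + if j + 1 = d then (d:ℝ)/2 else 0 := by
  have hd : (0:ℝ) < d := by exact_mod_cast (by omega : 0 < d)
  set θ : ℝ := ((j:ℝ)+1) * π / d with hθ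
  have h1 : ∀ k : ℕ, Real.sin (((j:ℝ)+1) * ((2 * (k:ℝ) + 1) * π / (2 * d))) ^ 2
      = 1/2 - 1/2 * Real.cos ((2*k+1) * θ) := by
    intro k
    rw [Real.sin_sq_eq_half_sub]
    have : 2 * (((j:ℝ)+1) * ((2 * (k:ℝ) + 1) * π / (2 * d))) = (2*k+1) * θ := by
      rw [hθ]; field_simp
    rw [this]; ring
  simp only [h1]
  rw [Finset.sum_sub_distrib, ← Finset.mul_sum]
  split_ifs with h
  · have hθπ : θ = π := by
      rw [hθ, ← h]; push_cast; field_simp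
    have : ∀ k : ℕ, Real.cos ((2*k+1)*θ) = -1 := by
      intro k
      rw [hθπ, show (2*(k:ℝ)+1)*π = π + k * (2*π) by ring, Real.cos_add_nat_mul_two_pi, Real.cos_pi]
    simp [this]; ring
  · have hj' : (j:ℝ)+1 < d := by exact_mod_cast (by omega : j + 1 < d)
    have hs : 0 < Real.sin θ := by
      apply Real.sin_pos_of_pos_of_lt_pi
      · rw [hθ]; positivity
      · rw [hθ, div_lt_iff₀ hd]; nlinarith [Real.pi_pos]
    have ht : ∑ k ∈ Finset.range d, 2 * Real.sin θ * Real.cos ((2*k+1)*θ) = 0 := by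
      have : ∀ k : ℕ, 2 * Real.sin θ * Real.cos ((2*k+1)*θ)
          = Real.sin (2*((k+1:ℕ):ℝ)*θ) - Real.sin (2*(k:ℝ)*θ) := by
        intro k
        rw [show 2*((k+1:ℕ):ℝ)*θ = (2*k+1)*θ + θ by push_cast; ring,
          show 2*(k:ℝ)*θ = (2*k+1)*θ - θ by ring, Real.sin_add, Real.sin_sub]
        ring
      simp only [this]
      rw [Finset.sum_range_sub (fun k : ℕ => Real.sin (2*(k:ℝ)*θ))]
      have : 2*(d:ℝ)*θ = ((2*(j+1):ℕ):ℝ) * π := by rw [hθ]; push_cast; field_simp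
      rw [this, Real.sin_nat_mul_pi]; simp
    rw [← Finset.mul_sum] at ht
    have := (mul_eq_zero.mp ht).resolve_left (by positivity)
    rw [this]; simp; ring

/-- for the Chebyshev-segment Vandermonde matrices with arc
parameter `ρ = a/d`, `0 < a ≤ π/2`, the Frobenius norms converge to
`√(2a Si(2a) + cos(2a) − 1)`. -/
theorem stmt_12 (a : ℝ) (ha : 0 < a) (ha' : a ≤ π / 2)
    (V : ∀ d : ℕ, Matrix (Fin d) (Fin d) ℝ)
    (hV : ∀ d : ℕ, 1 ≤ d → ∀ k j : Fin d,
      V d k j = 2 / (j.1 + 1)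
        * Real.sin ((j.1 + 1) * ((2 * k.1 + 1) * π / (2 * d)))
        * Real.sin ((j.1 + 1) * (a / d))) :
    Tendsto (fun d : ℕ => frobNorm (V d)) atTop
      (nhds (Real.sqrt (2 * a * Si (2 * a) + Real.cos (2 * a) - 1))) := by
  unfold frobNorm
  apply (Real.continuous_sqrt.tendsto _).comp
  have hc : Continuous (fun x : ℝ => 2 * a^2 * Real.sinc (a*x) ^ 2) :=
    continuous_const.mul ((Real.continuous_sinc.comp (continuous_const.mul continuous_id)).pow 2)
  have hr := riemann_aux _ hc
  rw [sinc_int a ha] at hr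
  have h0 : Tendsto (fun d : ℕ => 2 * Real.sin a ^ 2 * (1 / (d:ℝ))) atTop (nhds 0) := by
    have := (tendsto_one_div_atTop_nhds_zero_nat (𝕜 := ℝ)).const_mul (2 * Real.sin a ^ 2)
    rwa [mul_zero] at this
  have hsum := hr.add h0
  rw [add_zero] at hsum
  refine hsum.congr' ?_
  filter_upwards [eventually_ge_atTop 1] with d hd
  have hd0 : (0:ℝ) < d := by exact_mod_cast hd
  rw [Finset.sum_comm]
  simp only [hV d hd, mul_pow]
  have e1 : ∀ j : Fin d, ∑ k : Fin d, (2 / ((j.1:ℝ) + 1)) ^ 2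
        * Real.sin ((j.1 + 1) * ((2 * k.1 + 1) * π / (2 * d))) ^ 2
        * Real.sin ((j.1 + 1) * (a / d)) ^ 2 =
      (fun j : ℕ => (1 / (d:ℝ)) * (2 * a^2 * Real.sinc (a * (((j:ℝ)+1)/d)) ^ 2)
        + if j = d - 1 then 2 * Real.sin a ^ 2 * (1 / (d:ℝ)) else 0) j.1 := by
    intro j
    rw [← Finset.sum_mul, ← Finset.mul_sum,
      Fin.sum_univ_eq_sum_range
        (fun k : ℕ => Real.sin (((j.1:ℝ)+1) * ((2 * (k:ℝ) + 1) * π / (2 * d))) ^ 2) d,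
      sum_sin_sq d j.1 j.2]
    have hj0 : (0:ℝ) < (j.1:ℝ) + 1 := by positivity
    have hne : a * (((j.1:ℝ)+1)/d) ≠ 0 := by positivity
    have hs : ((j.1:ℝ) + 1) * (a / d) = a * (((j.1:ℝ)+1)/d) := by ring
    simp only []
    rw [Real.sinc_of_ne_zero hne, hs]
    by_cases h : j.1 + 1 = d
    · have h' : j.1 = d - 1 := by omega
      have hh : (j.1:ℝ) + 1 = d := by exact_mod_cast h
      rw [if_pos h, if_pos h', hh, div_self hd0.ne', mul_one]
      field_simp
      try ring
    · have h' : ¬ j.1 = d - 1 := by omega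
      rw [if_neg h, if_neg h']
      field_simp
      try ring
  rw [Finset.sum_congr rfl (fun j _ => e1 j), Fin.sum_univ_eq_sum_range
    (fun j : ℕ => (1 / (d:ℝ)) * (2 * a^2 * Real.sinc (a * (((j:ℝ)+1)/d)) ^ 2)
        + if j = d - 1 then 2 * Real.sin a ^ 2 * (1 / (d:ℝ)) else 0) d, Finset.sum_add_distrib,
    Finset.sum_ite_eq', if_pos (Finset.mem_range.2 (by omega)), Finset.mul_sum]
end

section
/- Let 0 < a ≤ π/2 and, for each integer d ≥ 1, let V_d = V_d(a/d) be the Chebyshev-segment Vandermonde matrix with arc parameter ρ = a/d. Then the Frobenius condition number κ_F(V_d) = ‖V_d‖_F · ‖V_d⁻¹‖_F grows asymptotically linearly in d: there exist constants c₁, c₂ > 0 and an integer D such that for every d ≥ D, c₁·d ≤ ‖V_d‖_F · ‖V_d⁻¹‖_F ≤ c₂·d. -/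
open Real Matrix

lemma cos_sum (d m : ℕ) (hd : 1 ≤ d) (hm : 0 < m) (hm2 : m < 2 * d) :
    ∑ k : Fin d, Real.cos (m * ((2 * k.1 + 1) * π / (2 * d))) = 0 := by
  have hd0 : (0 : ℝ) < d := by exact_mod_cast hd
  set h : ℝ := m * π / (2 * d) with hh
  have hm0 : (0 : ℝ) < m := by exact_mod_cast hm
  have hm2' : (m : ℝ) < 2 * d := by exact_mod_cast hm2
  have hs : 0 < Real.sin h := by
    apply Real.sin_pos_of_pos_of_lt_pi
    · positivity
    · rw [hh, div_lt_iff₀ (by positivity)]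
      nlinarith [Real.pi_pos]
  have tel : ∀ n : ℕ, 2 * Real.sin h * ∑ k ∈ Finset.range n,
      Real.cos (m * ((2 * (k : ℝ) + 1) * π / (2 * d))) = Real.sin (2 * n * h) := by
    intro n
    induction n with
    | zero => simp
    | succ n ih =>
      rw [Finset.sum_range_succ, mul_add, ih]
      have e1 : (m : ℝ) * ((2 * (n : ℝ) + 1) * π / (2 * d)) = 2 * n * h + h := by
        rw [hh]; ring
      have e2 : 2 * ((n + 1 : ℕ) : ℝ) * h = (2 * n * h + h) + h := by
        push_cast; ring
      have e3 : 2 * (n : ℝ) * h = (2 * n * h + h) - h := by ring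
      rw [e1, e2, Real.sin_add (2 * n * h + h) h]
      nth_rewrite 1 [e3]
      rw [Real.sin_sub]
      ring
  have t := tel d
  have e : 2 * (d : ℝ) * h = m * π := by rw [hh]; field_simp
  rw [e, Real.sin_nat_mul_pi] at t
  rw [Fin.sum_univ_eq_sum_range (fun k : ℕ => Real.cos (m * ((2 * (k : ℝ) + 1) * π / (2 * d))))]
  rcases mul_eq_zero.mp t with t | t
  · linarith
  · exact t

lemma cos_sum_top (d : ℕ) (hd : 1 ≤ d) :
    ∑ k : Fin d, Real.cos ((2 * d : ℕ) * ((2 * k.1 + 1) * π / (2 * d))) = -d := by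
  have hd0 : (0 : ℝ) < d := by exact_mod_cast hd
  have : ∀ k : Fin d, Real.cos ((2 * d : ℕ) * ((2 * k.1 + 1) * π / (2 * d))) = -1 := by
    intro k
    have e : ((2 * d : ℕ) : ℝ) * ((2 * k.1 + 1) * π / (2 * d)) = π + (k.1 : ℕ) * (2 * π) := by
      push_cast; field_simp; ring
    rw [e, Real.cos_add_nat_mul_two_pi, Real.cos_pi]
  rw [Finset.sum_congr rfl fun k _ => this k]
  simp

lemma prod_sin (x : ℝ) (p q : ℕ) (h : q ≤ p) :
    Real.sin (p * x) * Real.sin (q * x)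
      = (Real.cos ((p - q : ℕ) * x) - Real.cos ((p + q : ℕ) * x)) / 2 := by
  rw [Nat.cast_sub h]
  push_cast
  rw [sub_mul, add_mul, Real.cos_sub, Real.cos_add]
  ring

lemma orth_lt (d p q : ℕ) (hd : 1 ≤ d) (hq : 0 < q) (hqp : q < p) (hp : p ≤ d) :
    ∑ k : Fin d, Real.sin (p * ((2 * k.1 + 1) * π / (2 * d)))
      * Real.sin (q * ((2 * k.1 + 1) * π / (2 * d))) = 0 := by
  simp_rw [prod_sin _ p q hqp.le, ← Finset.sum_div, Finset.sum_sub_distrib]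
  rw [cos_sum d _ hd (by omega) (by omega), cos_sum d _ hd (by omega) (by omega)]
  simp

lemma orth_eq (d p : ℕ) (hd : 1 ≤ d) (h0 : 0 < p) (hp : p ≤ d) :
    (d : ℝ) / 2 ≤ ∑ k : Fin d, Real.sin (p * ((2 * k.1 + 1) * π / (2 * d))) ^ 2 ∧
    ∑ k : Fin d, Real.sin (p * ((2 * k.1 + 1) * π / (2 * d))) ^ 2 ≤ d := by
  constructor
  · simp_rw [pow_two, prod_sin _ p p le_rfl, ← Finset.sum_div, Finset.sum_sub_distrib]
    have hz : ∑ k : Fin d, Real.cos (((p - p : ℕ) : ℝ) * ((2 * k.1 + 1) * π / (2 * d))) = d := by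
      simp
    rw [hz]
    rcases hp.lt_or_eq with h | h
    · rw [cos_sum d _ hd (by omega) (by omega)]; simp
    · have : p + p = 2 * d := by omega
      rw [this, cos_sum_top d hd]
      have : (0 : ℝ) ≤ d := by positivity
      linarith
  · calc _ ≤ ∑ k : Fin d, (1 : ℝ) := Finset.sum_le_sum (fun k _ => Real.sin_sq_le_one _)
      _ = d := by simp

lemma generic {d : ℕ} (A : Matrix (Fin d) (Fin d) ℝ) (w : Fin d → ℝ) (L U : ℝ) (hL : 0 < L)
    (hU : U ≤ 16 * L) (hw : ∀ j, L ≤ w j) (hw' : ∀ j, w j ≤ U)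
    (hA : Aᵀ * A = Matrix.diagonal w) (hd : 1 ≤ d) :
    1 / 4 * (d : ℝ) ≤ frobNorm A * frobNorm A⁻¹ ∧ frobNorm A * frobNorm A⁻¹ ≤ 4 * d := by
  have hw0 : ∀ j, 0 < w j := fun j => hL.trans_le (hw j)
  have hU0 : 0 < U := (hw0 ⟨0, hd⟩).trans_le (hw' _)
  have hinv : A⁻¹ = Matrix.diagonal (fun j => (w j)⁻¹) * Aᵀ := by
    apply Matrix.inv_eq_left_inv
    rw [Matrix.mul_assoc, hA, Matrix.diagonal_mul_diagonal, ← Matrix.diagonal_one]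
    congr 1
    ext j
    exact inv_mul_cancel₀ (hw0 j).ne'
  have hcol : ∀ j, ∑ k, A k j ^ 2 = w j := by
    intro j
    have := congrFun (congrFun hA j) j
    simp only [Matrix.mul_apply, Matrix.transpose_apply, Matrix.diagonal_apply_eq] at this
    simpa [pow_two] using this
  have s1 : ∑ i, ∑ j, A i j ^ 2 = ∑ j, w j := by
    rw [Finset.sum_comm]; simp [hcol]
  have s2 : ∑ i, ∑ j, (A⁻¹) i j ^ 2 = ∑ j, (w j)⁻¹ := by
    refine Finset.sum_congr rfl fun i _ => ?_
    simp_rw [hinv, Matrix.diagonal_mul, Matrix.transpose_apply, mul_pow, ← Finset.mul_sum, hcol]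
    have := (hw0 i).ne'
    field_simp
  have b1 : d * L ≤ ∑ j, w j := by
    calc d * L = ∑ j : Fin d, L := by simp
      _ ≤ _ := Finset.sum_le_sum fun j _ => hw j
  have b2 : ∑ j, w j ≤ d * U := by
    calc _ ≤ ∑ j : Fin d, U := Finset.sum_le_sum fun j _ => hw' j
      _ = _ := by simp
  have b3 : d * U⁻¹ ≤ ∑ j, (w j)⁻¹ := by
    calc d * U⁻¹ = ∑ j : Fin d, U⁻¹ := by simp
      _ ≤ _ := Finset.sum_le_sum fun j _ => inv_anti₀ (hw0 j) (hw' j)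
  have b4 : ∑ j, (w j)⁻¹ ≤ d * L⁻¹ := by
    calc _ ≤ ∑ j : Fin d, L⁻¹ := Finset.sum_le_sum fun j _ => inv_anti₀ hL (hw j)
      _ = _ := by simp
  have n1 : 0 ≤ ∑ j, w j := Finset.sum_nonneg fun j _ => (hw0 j).le
  have n2 : 0 ≤ ∑ j, (w j)⁻¹ := Finset.sum_nonneg fun j _ => (inv_pos.2 (hw0 j)).le
  have hr : U * L⁻¹ ≤ 16 := by rw [← div_eq_mul_inv, div_le_iff₀ hL]; exact hU
  have hr' : 1 / 16 ≤ L * U⁻¹ := by rw [← div_eq_mul_inv, le_div_iff₀ hU0]; linarith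
  unfold frobNorm
  rw [s1, s2, ← Real.sqrt_mul n1]
  constructor
  · apply Real.le_sqrt_of_sq_le
    calc (1 / 4 * (d : ℝ)) ^ 2 = d ^ 2 * (1 / 16) := by ring
      _ ≤ d ^ 2 * (L * U⁻¹) := by gcongr
      _ = (d * L) * (d * U⁻¹) := by ring
      _ ≤ _ := by gcongr
  · apply Real.sqrt_le_iff.2 ⟨by positivity, ?_⟩
    calc _ ≤ (d * U) * (d * L⁻¹) := by gcongr
      _ = d ^ 2 * (U * L⁻¹) := by ring
      _ ≤ d ^ 2 * 16 := by gcongr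
      _ = _ := by ring

/-- for the Chebyshev-segment Vandermonde matrices with arc
parameter `ρ = a/d`, `0 < a ≤ π/2`, the Frobenius condition number
`κ_F(V_d) = ‖V_d‖_F ‖V_d⁻¹‖_F` grows asymptotically linearly in `d`. -/
theorem stmt_15 (a : ℝ) (ha : 0 < a) (ha' : a ≤ π / 2)
    (V : ∀ d : ℕ, Matrix (Fin d) (Fin d) ℝ)
    (hV : ∀ d : ℕ, 1 ≤ d → ∀ k j : Fin d,
      V d k j = 2 / (j.1 + 1)
        * Real.sin ((j.1 + 1) * ((2 * k.1 + 1) * π / (2 * d)))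
        * Real.sin ((j.1 + 1) * (a / d))) :
    ∃ c₁ c₂ : ℝ, ∃ D : ℕ, 0 < c₁ ∧ 0 < c₂ ∧ ∀ d : ℕ, D ≤ d →
      c₁ * d ≤ frobNorm (V d) * frobNorm (V d)⁻¹ ∧
        frobNorm (V d) * frobNorm (V d)⁻¹ ≤ c₂ * d := by
  refine ⟨1 / 4, 4, 1, by norm_num, by norm_num, fun d hd => ?_⟩
  have hd0 : (0 : ℝ) < d := by exact_mod_cast hd
  have hpi := Real.pi_pos
  set δ : Fin d → ℝ := fun j => 2 / (j.1 + 1) * Real.sin ((j.1 + 1) * (a / d)) with hδ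
  set n : Fin d → ℝ := fun j =>
    ∑ k : Fin d, Real.sin ((j.1 + 1 : ℕ) * ((2 * k.1 + 1) * π / (2 * d))) ^ 2 with hn
  have hVe : ∀ k j, V d k j =
      δ j * Real.sin ((j.1 + 1 : ℕ) * ((2 * k.1 + 1) * π / (2 * d))) := by
    intro k j
    rw [hV d hd, hδ]
    push_cast
    ring
  have hnb : ∀ j, (d : ℝ) / 2 ≤ n j ∧ n j ≤ d := fun j =>
    orth_eq d (j.1 + 1) hd (by omega) j.2
  have hδb : ∀ j, 4 * a / (π * d) ≤ δ j ∧ δ j ≤ 2 * a / d := by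
    intro j
    have hj : (0 : ℝ) < j.1 + 1 := by positivity
    have hjd : (j.1 : ℝ) + 1 ≤ d := by exact_mod_cast j.2
    have hx : 0 ≤ ((j.1 : ℝ) + 1) * (a / d) := by positivity
    have hx2 : ((j.1 : ℝ) + 1) * (a / d) ≤ π / 2 := by
      calc _ ≤ (d : ℝ) * (a / d) := by gcongr
        _ = a := by field_simp
        _ ≤ _ := ha'
    constructor
    · calc 4 * a / (π * d) = 2 / ((j.1 : ℝ) + 1) * (2 / π * ((j.1 + 1) * (a / d))) := by
            field_simp; ring
        _ ≤ _ := by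
            have := Real.mul_le_sin hx hx2
            simp only [hδ]
            gcongr
    · calc δ j ≤ 2 / ((j.1 : ℝ) + 1) * ((j.1 + 1) * (a / d)) := by
            have := Real.sin_le hx
            simp only [hδ]
            gcongr
        _ = _ := by field_simp
  have hlow : 0 < 4 * a / (π * d) := by positivity
  apply generic (V d) (fun j => δ j ^ 2 * n j) ((4 * a / (π * d)) ^ 2 * (d / 2))
    ((2 * a / d) ^ 2 * d) (by positivity) ?_ ?_ ?_ ?_ hd
  · have e : 16 * ((4 * a / (π * d)) ^ 2 * ((d : ℝ) / 2)) = (2 * a / d) ^ 2 * d * (32 / π ^ 2) := by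
      field_simp; ring
    rw [e]
    apply le_mul_of_one_le_right (by positivity)
    rw [le_div_iff₀ (by positivity)]
    nlinarith [Real.pi_le_four]
  · intro j
    have h1 := (hnb j).1
    have h2 := (hδb j).1
    show _ ≤ δ j ^ 2 * n j
    gcongr
  · intro j
    have h1 := (hnb j).2
    have h2 := (hδb j).2
    have h3 : 0 ≤ δ j := hlow.le.trans (hδb j).1
    show δ j ^ 2 * n j ≤ _
    gcongr
  · ext i j
    rw [Matrix.mul_apply]
    simp only [Matrix.transpose_apply, hVe]
    by_cases hij : i = j
    · subst hij
      rw [Matrix.diagonal_apply_eq]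
      simp only [hn]
      rw [Finset.mul_sum]
      exact Finset.sum_congr rfl fun k _ => by ring
    · rw [Matrix.diagonal_apply_ne _ hij]
      have hne : i.1 ≠ j.1 := fun h => hij (Fin.ext h)
      rcases lt_or_gt_of_ne hne with h | h
      · have := orth_lt d (j.1 + 1) (i.1 + 1) hd (by omega) (by omega) j.2
        rw [← mul_zero (δ i * δ j), ← this, Finset.mul_sum]
        exact Finset.sum_congr rfl fun k _ => by ring
      · have := orth_lt d (i.1 + 1) (j.1 + 1) hd (by omega) (by omega) i.2
        rw [← mul_zero (δ i * δ j), ← this, Finset.mul_sum]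
        exact Finset.sum_congr rfl fun k _ => by ring
end
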